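/- Let B2 be the set of real numbers [0; a1, a2, …] whose continued fraction partial quotients all lie in {1,2} and whose digit sequence contains none of the following sixteen strings, nor their reverses, as a consecutive substring: 21212, 21112121, 211121222, 111112121, 12111212, 111212111, 21112122112, 222111212211, 12211112121122, 112211121221111, 22111121211221, 21122111212211, 2111212211112, 22221111212112222, 111122111212211122, 221221112122111111. Then 0.499975 < dim_H B2 < 0.499995. -/

import Mathlib

open Filter

/-- Numerators of the convergents of the continued fraction `[a 0; a 1, a 2, …]`. -/
def cfNum (a : ℕ → ℕ) : ℕ → ℕ
  | 0 => a 0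
  | 1 => a 1 * a 0 + 1
  | n + 2 => a (n + 2) * cfNum a (n + 1) + cfNum a n

/-- Denominators of the convergents of the continued fraction `[a 0; a 1, a 2, …]`. -/
def cfDen (a : ℕ → ℕ) : ℕ → ℕ
  | 0 => 1
  | 1 => a 1
  | n + 2 => a (n + 2) * cfDen a (n + 1) + cfDen a n

/-- Value of the infinite continued fraction `[a 0; a 1, a 2, …]` (the limit of its
convergents). -/
noncomputable def cfVal (a : ℕ → ℕ) : ℝ :=
  limUnder atTop fun n => (cfNum a n : ℝ) / (cfDen a n)

/-- Value of the infinite continued fraction `[0; a 0, a 1, …]`. -/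
noncomputable def cf01 (a : ℕ → ℕ) : ℝ := 1 / cfVal a

/-- `λ₀(α) = [α 0; α 1, α 2, …] + [0; α (-1), α (-2), …]`. -/
noncomputable def lambda0 (α : ℤ → ℕ) : ℝ :=
  cfVal (fun n : ℕ => α (n : ℤ)) + cf01 (fun n : ℕ => α (-((n : ℤ) + 1)))

/-- The shift `σ^N` on bi-infinite sequences. -/
def shiftZ (N : ℤ) (α : ℤ → ℕ) : ℤ → ℕ := fun i => α (i + N)

/-- The Markov value `m(α) = sup_{n ∈ ℤ} λ₀(σⁿ α)`. -/
noncomputable def markovValue (α : ℤ → ℕ) : ℝ := ⨆ n : ℤ, lambda0 (shiftZ n α)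

/-- The Lagrange value `ℓ(α) = limsup_{n → +∞} λ₀(σⁿ α)`. -/
noncomputable def lagrangeValue (α : ℤ → ℕ) : ℝ :=
  limsup (fun n : ℕ => lambda0 (shiftZ (n : ℤ) α)) atTop

/-- The Markov spectrum `M`. -/
def MarkovSpectrum : Set ℝ :=
  { x | ∃ α : ℤ → ℕ, (∀ i, 1 ≤ α i) ∧ markovValue α = x }

/-- The Lagrange spectrum `L`. -/
def LagrangeSpectrum : Set ℝ :=
  { x | ∃ α : ℤ → ℕ, (∀ i, 1 ≤ α i) ∧ lagrangeValue α = x }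

/-- The finite word `w` occurs in the one-sided sequence `a` starting at position `i`. -/
def occursAtN (a : ℕ → ℕ) (i : ℕ) (w : List ℕ) : Prop :=
  ∀ j < w.length, a (i + j) = w.getD j 0

/-- The Gauss–Cantor set of reals `[0; a₁, a₂, …]` whose partial quotients all lie in `D`
and whose digit sequence contains no word of `F`, nor the reverse of a word of `F`, as a
consecutive substring. -/
noncomputable def gaussCantorRev (D : Set ℕ) (F : List (List ℕ)) : Set ℝ :=
  { x | ∃ a : ℕ → ℕ, (∀ n, a n ∈ D) ∧
      (∀ w ∈ F, ∀ i, ¬ occursAtN a i w ∧ ¬ occursAtN a i w.reverse) ∧ x = cf01 a }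

/-- The Gauss–Cantor set of reals `[0; a₁, a₂, …]` whose partial quotients all lie in `D`
and whose digit sequence contains no word of `F` as a consecutive substring. -/
noncomputable def gaussCantor (D : Set ℕ) (F : List (List ℕ)) : Set ℝ :=
  { x | ∃ a : ℕ → ℕ, (∀ n, a n ∈ D) ∧ (∀ w ∈ F, ∀ i, ¬ occursAtN a i w) ∧ x = cf01 a }

/-- The 16 forbidden words defining the Cantor set `B₂`. -/
def forbiddenB2 : List (List ℕ) :=
  [[2, 1, 2, 1, 2],
   [2, 1, 1, 1, 2, 1, 2, 1],
   [2, 1, 1, 1, 2, 1, 2, 2, 2],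
   [1, 1, 1, 1, 1, 2, 1, 2, 1],
   [1, 2, 1, 1, 1, 2, 1, 2],
   [1, 1, 1, 2, 1, 2, 1, 1, 1],
   [2, 1, 1, 1, 2, 1, 2, 2, 1, 1, 2],
   [2, 2, 2, 1, 1, 1, 2, 1, 2, 2, 1, 1],
   [1, 2, 2, 1, 1, 1, 1, 2, 1, 2, 1, 1, 2, 2],
   [1, 1, 2, 2, 1, 1, 1, 2, 1, 2, 2, 1, 1, 1, 1],
   [2, 2, 1, 1, 1, 1, 2, 1, 2, 1, 1, 2, 2, 1],
   [2, 1, 1, 2, 2, 1, 1, 1, 2, 1, 2, 2, 1, 1],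
   [2, 1, 1, 1, 2, 1, 2, 2, 1, 1, 1, 1, 2],
   [2, 2, 2, 2, 1, 1, 1, 1, 2, 1, 2, 1, 1, 2, 2, 2, 2],
   [1, 1, 1, 1, 2, 2, 1, 1, 1, 2, 1, 2, 2, 1, 1, 1, 2, 2],
   [2, 2, 1, 2, 2, 1, 1, 1, 2, 1, 2, 2, 1, 1, 1, 1, 1, 1]]


section ContinuedFraction

/-- The digits of `a` are `1` or `2`. -/
def IsDigitSeq (a : ℕ → ℕ) : Prop := ∀ n, a n = 1 ∨ a n = 2

/-- The sequence without its first digit. -/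
def tailSeq (a : ℕ → ℕ) : ℕ → ℕ := fun n => a (n + 1)

theorem IsDigitSeq.tailSeq {a : ℕ → ℕ} (ha : IsDigitSeq a) : IsDigitSeq (tailSeq a) :=
  fun n => ha (n + 1)

theorem cfNum_cfDen_succ (a : ℕ → ℕ) (n : ℕ) :
    cfNum a (n + 1) = a 0 * cfNum (tailSeq a) n + cfDen (tailSeq a) n ∧
      cfDen a (n + 1) = cfNum (tailSeq a) n := by
  induction n using Nat.twoStepInduction with
  | zero => simp [cfNum, cfDen, tailSeq, mul_comm]
  | one =>
    simp only [cfNum, cfDen, tailSeq]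
    exact ⟨by ring, trivial⟩
  | more n h₁ h₂ =>
    have e₁ : cfNum a (n + 2 + 1) = a (n + 3) * cfNum a (n + 2) + cfNum a (n + 1) := rfl
    have e₂ : cfDen a (n + 2 + 1) = a (n + 3) * cfDen a (n + 2) + cfDen a (n + 1) := rfl
    have e₃ : cfNum (tailSeq a) (n + 2) =
      a (n + 3) * cfNum (tailSeq a) (n + 1) + cfNum (tailSeq a) n := rfl
    have e₄ : cfDen (tailSeq a) (n + 2) =
      a (n + 3) * cfDen (tailSeq a) (n + 1) + cfDen (tailSeq a) n := rfl
    rw [e₁, e₂, e₃, e₄, h₁.1, h₁.2, h₂.1, h₂.2]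
    constructor
    · ring
    · rfl

theorem cfNum_cfDen_pos {a : ℕ → ℕ} (ha : IsDigitSeq a) (n : ℕ) :
    0 < cfNum a n ∧ 0 < cfDen a n := by
  induction n generalizing a with
  | zero => rcases ha 0 with h | h <;> simp [cfNum, cfDen, h]
  | succ n ih =>
    rw [(cfNum_cfDen_succ a n).1, (cfNum_cfDen_succ a n).2]
    have := ih ha.tailSeq
    exact ⟨by omega, this.1⟩

/-- The convergents of `[a 0; a 1, …]`. -/
noncomputable def cfConv (a : ℕ → ℕ) (n : ℕ) : ℝ := (cfNum a n : ℝ) / cfDen a n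

theorem cfConv_succ {a : ℕ → ℕ} (ha : IsDigitSeq a) (n : ℕ) :
    cfConv a (n + 1) = a 0 + 1 / cfConv (tailSeq a) n := by
  have h := cfNum_cfDen_pos ha.tailSeq n
  have h₁ : (0 : ℝ) < cfNum (tailSeq a) n := by exact_mod_cast h.1
  have h₂ : (0 : ℝ) < cfDen (tailSeq a) n := by exact_mod_cast h.2
  unfold cfConv
  rw [(cfNum_cfDen_succ a n).1, (cfNum_cfDen_succ a n).2]
  push_cast
  field_simp

theorem IsDigitSeq.one_le {a : ℕ → ℕ} (ha : IsDigitSeq a) (n : ℕ) : (1 : ℝ) ≤ a n := by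
  rcases ha n with h | h <;> norm_num [h]

theorem IsDigitSeq.le_two {a : ℕ → ℕ} (ha : IsDigitSeq a) (n : ℕ) : (a n : ℝ) ≤ 2 := by
  rcases ha n with h | h <;> norm_num [h]

theorem cfConv_mem {a : ℕ → ℕ} (ha : IsDigitSeq a) (n : ℕ) :
    1 ≤ cfConv a n ∧ cfConv a n ≤ 3 := by
  induction n generalizing a with
  | zero =>
    have := ha.one_le 0
    have := ha.le_two 0
    simp only [cfConv, cfNum, cfDen, Nat.cast_one, div_one]
    constructor <;> linarith
  | succ n ih =>
    obtain ⟨h₁, h₂⟩ := ih ha.tailSeq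
    have := ha.one_le 0
    have := ha.le_two 0
    have h₃ : 0 < 1 / cfConv (tailSeq a) n := by positivity
    have h₄ : 1 / cfConv (tailSeq a) n ≤ 1 := by
      rw [div_le_one (by linarith)]; exact h₁
    rw [cfConv_succ ha]
    constructor <;> linarith

theorem four_thirds_le_cfConv_succ {a : ℕ → ℕ} (ha : IsDigitSeq a) (n : ℕ) :
    4 / 3 ≤ cfConv a (n + 1) := by
  obtain ⟨h₁, h₂⟩ := cfConv_mem ha.tailSeq n
  have := ha.one_le 0
  have h₃ : 1 / 3 ≤ 1 / cfConv (tailSeq a) n := one_div_le_one_div_of_le (by linarith) h₂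
  rw [cfConv_succ ha]
  linarith

theorem abs_cfConv_sub_le {a : ℕ → ℕ} (ha : IsDigitSeq a) (k : ℕ) {n m : ℕ} (hn : k + 1 ≤ n)
    (hm : k + 1 ≤ m) : |cfConv a n - cfConv a m| ≤ 2 * (9 / 16) ^ k := by
  induction k generalizing a n m with
  | zero =>
    have h₁ := cfConv_mem ha n
    have h₂ := cfConv_mem ha m
    rw [abs_le]
    constructor <;> norm_num <;> linarith
  | succ k ih =>
    obtain ⟨n, rfl⟩ := Nat.exists_eq_add_of_le' hn
    obtain ⟨m, rfl⟩ := Nat.exists_eq_add_of_le' hm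
    have h := ih ha.tailSeq (n := n + k + 1) (m := m + k + 1) (by omega) (by omega)
    have h₁ := four_thirds_le_cfConv_succ ha.tailSeq (n + k)
    have h₂ := four_thirds_le_cfConv_succ ha.tailSeq (m + k)
    have e₁ := cfConv_succ ha (n + k + 1)
    have e₂ := cfConv_succ ha (m + k + 1)
    rw [show n + (k + 1 + 1) = n + k + 1 + 1 by ring, show m + (k + 1 + 1) = m + k + 1 + 1 by ring,
      e₁, e₂]
    set x := cfConv (tailSeq a) (n + k + 1)
    set y := cfConv (tailSeq a) (m + k + 1)
    have hx : 0 < x := by linarith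
    have hy : 0 < y := by linarith
    have hxy : 16 / 9 ≤ x * y := by nlinarith
    have e : (a 0 + 1 / x) - (a 0 + 1 / y) = (y - x) / (x * y) := by field_simp; ring
    rw [e, abs_div, abs_of_pos (mul_pos hx hy), abs_sub_comm, div_le_iff₀ (mul_pos hx hy)]
    have hp : (0 : ℝ) < (9 / 16) ^ k := by positivity
    rw [pow_succ]
    nlinarith

theorem tendsto_cfConv {a : ℕ → ℕ} (ha : IsDigitSeq a) :
    Tendsto (cfConv a) atTop (nhds (cfVal a)) := by
  apply tendsto_nhds_limUnder
  apply cauchySeq_tendsto_of_complete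
  rw [← cauchySeq_shift 1]
  refine cauchySeq_of_le_tendsto_0 (fun k => 2 * (9 / 16 : ℝ) ^ k) ?_ ?_
  · intro n m k hn hm
    rw [Real.dist_eq]
    exact abs_cfConv_sub_le ha k (by omega) (by omega)
  · have := tendsto_pow_atTop_nhds_zero_of_lt_one (r := (9 / 16 : ℝ)) (by norm_num) (by norm_num)
    simpa using this.const_mul 2

theorem one_le_cfVal {a : ℕ → ℕ} (ha : IsDigitSeq a) : 1 ≤ cfVal a :=
  ge_of_tendsto' (tendsto_cfConv ha) fun n => (cfConv_mem ha n).1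

theorem cfVal_eq {a : ℕ → ℕ} (ha : IsDigitSeq a) : cfVal a = a 0 + cf01 (tailSeq a) := by
  refine tendsto_nhds_unique ((tendsto_cfConv ha).comp (tendsto_add_atTop_nat 1)) ?_
  have h := (tendsto_cfConv ha.tailSeq).inv₀ (by linarith [one_le_cfVal ha.tailSeq])
  refine ((h.const_add (a 0 : ℝ)).congr fun n => ?_).trans (by simp [cf01])
  simp [cfConv_succ ha]

theorem cf01_eq {a : ℕ → ℕ} (ha : IsDigitSeq a) : cf01 a = 1 / (a 0 + cf01 (tailSeq a)) := by
  rw [← cfVal_eq ha, cf01]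

theorem cf01_pos {a : ℕ → ℕ} (ha : IsDigitSeq a) : 0 < cf01 a := by
  have := one_le_cfVal ha
  unfold cf01
  positivity

theorem cf01_le_one {a : ℕ → ℕ} (ha : IsDigitSeq a) : cf01 a ≤ 1 := by
  have := one_le_cfVal ha
  rw [cf01, div_le_one (by linarith)]
  exact this

theorem one_third_le_cf01 {a : ℕ → ℕ} (ha : IsDigitSeq a) : 1 / 3 ≤ cf01 a := by
  have h₁ := cf01_pos ha.tailSeq
  have h₂ := cf01_le_one ha.tailSeq
  have := ha.le_two 0
  have := ha.one_le 0
  rw [cf01_eq ha]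
  exact one_div_le_one_div_of_le (by linarith) (by linarith)

theorem cf01_le_three_quarters {a : ℕ → ℕ} (ha : IsDigitSeq a) : cf01 a ≤ 3 / 4 := by
  have h₁ := one_third_le_cf01 ha.tailSeq
  have := ha.one_le 0
  rw [cf01_eq ha, div_le_iff₀ (by linarith)]
  linarith

theorem one_seventh_le_abs_cf01_sub {a b : ℕ → ℕ} (ha : IsDigitSeq a) (hb : IsDigitSeq b)
    (hab : a 0 ≠ b 0) : 1 / 7 ≤ |cf01 a - cf01 b| := by
  have key : ∀ {a b : ℕ → ℕ}, IsDigitSeq a → IsDigitSeq b → a 0 = 1 → b 0 = 2 →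
      1 / 7 ≤ cf01 a - cf01 b := by
    intro a b ha hb h₁ h₂
    have h₃ := one_third_le_cf01 hb.tailSeq
    have h₄ := cf01_le_three_quarters ha.tailSeq
    have h₅ := cf01_pos ha.tailSeq
    have e₁ : 4 / 7 ≤ cf01 a := by
      rw [cf01_eq ha, h₁, le_div_iff₀ (by push_cast; linarith)]
      push_cast
      linarith
    have e₂ : cf01 b ≤ 3 / 7 := by
      rw [cf01_eq hb, h₂, div_le_iff₀ (by push_cast; linarith)]
      push_cast
      linarith
    linarith
  rcases ha 0 with h₁ | h₁ <;> rcases hb 0 with h₂ | h₂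
  · exact absurd (h₁.trans h₂.symm) hab
  · exact (key ha hb h₁ h₂).trans (le_abs_self _)
  · rw [abs_sub_comm]
    exact (key hb ha h₂ h₁).trans (le_abs_self _)
  · exact absurd (h₁.trans h₂.symm) hab

/-- The first `n` digits of `a`, the most recent one first. -/
def pastWord (a : ℕ → ℕ) : ℕ → List ℕ
  | 0 => []
  | n + 1 => a n :: pastWord a n

/-- The ratio of consecutive denominators after reading the word `h`
(most recent digit first), started at `1 / 2`. -/
noncomputable def denRatio : List ℕ → ℝ
  | [] => 1 / 2
  | a :: h => 1 / (a + denRatio h)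

/-- The denominator after reading the word `h` (most recent digit first), started at `1`. -/
noncomputable def wordDen : List ℕ → ℝ
  | [] => 1
  | a :: h => (a + denRatio h) * wordDen h

/-- All letters of `h` are `1` or `2`. -/
def IsDigitWord (h : List ℕ) : Prop := ∀ a ∈ h, a = 1 ∨ a = 2

theorem IsDigitWord.of_cons {a : ℕ} {h : List ℕ} (H : IsDigitWord (a :: h)) : IsDigitWord h :=
  fun b hb => H b (List.mem_cons_of_mem a hb)

theorem IsDigitWord.one_le_head {a : ℕ} {h : List ℕ} (H : IsDigitWord (a :: h)) :
    (1 : ℝ) ≤ a := by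
  rcases H a List.mem_cons_self with h | h <;> norm_num [h]

theorem IsDigitWord.head_le_two {a : ℕ} {h : List ℕ} (H : IsDigitWord (a :: h)) :
    (a : ℝ) ≤ 2 := by
  rcases H a List.mem_cons_self with h | h <;> norm_num [h]

theorem IsDigitSeq.isDigitWord {a : ℕ → ℕ} (ha : IsDigitSeq a) (n : ℕ) :
    IsDigitWord (pastWord a n) := by
  induction n with
  | zero => intro b hb; simp [pastWord] at hb
  | succ n ih =>
    intro b hb
    rcases List.mem_cons.1 hb with rfl | hb
    · exact ha n
    · exact ih b hb

theorem length_pastWord (a : ℕ → ℕ) (n : ℕ) : (pastWord a n).length = n := by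
  induction n with
  | zero => rfl
  | succ n ih => simp [pastWord, ih]

theorem denRatio_mem {h : List ℕ} (H : IsDigitWord h) : 1 / 3 ≤ denRatio h ∧ denRatio h ≤ 1 := by
  induction h with
  | nil => norm_num [denRatio]
  | cons a h ih =>
    obtain ⟨h₁, h₂⟩ := ih H.of_cons
    have := H.one_le_head
    have := H.head_le_two
    refine ⟨one_div_le_one_div_of_le (by linarith) (by linarith), ?_⟩
    rw [denRatio, div_le_one (by linarith)]
    linarith

theorem four_thirds_pow_le_wordDen {h : List ℕ} (H : IsDigitWord h) :
    (4 / 3) ^ h.length ≤ wordDen h := by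
  induction h with
  | nil => norm_num [wordDen]
  | cons a h ih =>
    have h₁ := (denRatio_mem H.of_cons).1
    have := H.one_le_head
    rw [List.length_cons, pow_succ', wordDen]
    exact mul_le_mul (by linarith) (ih H.of_cons) (by positivity) (by linarith)

theorem wordDen_pos {h : List ℕ} (H : IsDigitWord h) : 0 < wordDen h :=
  lt_of_lt_of_le (by positivity) (four_thirds_pow_le_wordDen H)

/-- The sequence without its first `n` digits. -/
def dropSeq (n : ℕ) (a : ℕ → ℕ) : ℕ → ℕ := fun k => a (n + k)

theorem IsDigitSeq.dropSeq {a : ℕ → ℕ} (ha : IsDigitSeq a) (n : ℕ) : IsDigitSeq (dropSeq n a) :=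
  fun k => ha (n + k)

theorem cf01_dropSeq {a : ℕ → ℕ} (ha : IsDigitSeq a) (n : ℕ) :
    cf01 (dropSeq n a) = 1 / (a n + cf01 (dropSeq (n + 1) a)) := by
  rw [cf01_eq (ha.dropSeq n)]
  congr 4
  funext k
  simp only [tailSeq, dropSeq]
  congr 1
  ring

theorem prod_cf01_dropSeq {a : ℕ → ℕ} (ha : IsDigitSeq a) (n : ℕ) :
    wordDen (pastWord a n) * (1 + denRatio (pastWord a n) * cf01 (dropSeq n a)) *
      ∏ k ∈ Finset.range n, cf01 (dropSeq k a) = 1 + cf01 a / 2 := by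
  induction n with
  | zero =>
    have : dropSeq 0 a = a := by funext k; simp [dropSeq]
    simp [pastWord, wordDen, denRatio, this]
    ring
  | succ n ih =>
    have h₁ := (denRatio_mem (ha.isDigitWord n)).1
    have h₂ := ha.one_le n
    have h₃ := cf01_pos (ha.dropSeq (n + 1))
    rw [← ih, Finset.prod_range_succ, pastWord, wordDen, denRatio, cf01_dropSeq ha n]
    have h₄ : (a n : ℝ) + denRatio (pastWord a n) ≠ 0 := by linarith
    have h₅ : (a n : ℝ) + cf01 (dropSeq (n + 1) a) ≠ 0 := by linarith
    field_simp
    ring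

theorem prod_cf01_dropSeq_bounds {a : ℕ → ℕ} (ha : IsDigitSeq a) (n : ℕ) :
    1 / 2 / wordDen (pastWord a n) ≤ ∏ k ∈ Finset.range n, cf01 (dropSeq k a) ∧
      ∏ k ∈ Finset.range n, cf01 (dropSeq k a) ≤ 3 / 2 / wordDen (pastWord a n) := by
  have h := prod_cf01_dropSeq ha n
  obtain ⟨h₁, h₂⟩ := denRatio_mem (ha.isDigitWord n)
  have h₃ := cf01_pos (ha.dropSeq n)
  have h₄ := cf01_le_one (ha.dropSeq n)
  have h₅ := cf01_pos ha
  have h₆ := cf01_le_one ha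
  have hQ := wordDen_pos (ha.isDigitWord n)
  have hP : 0 < ∏ k ∈ Finset.range n, cf01 (dropSeq k a) :=
    Finset.prod_pos fun k _ => cf01_pos (ha.dropSeq k)
  set Q := wordDen (pastWord a n)
  set P := ∏ k ∈ Finset.range n, cf01 (dropSeq k a)
  have hrt : denRatio (pastWord a n) * cf01 (dropSeq n a) ≤ 1 :=
    mul_le_one₀ h₂ h₃.le h₄
  have hrt' : 0 ≤ denRatio (pastWord a n) * cf01 (dropSeq n a) := by positivity
  have hQP := mul_pos hQ hP
  constructor
  · rw [div_le_iff₀ hQ]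
    nlinarith
  · rw [le_div_iff₀ hQ]
    nlinarith

theorem cf01_sub_eq {a b : ℕ → ℕ} (ha : IsDigitSeq a) (hb : IsDigitSeq b) {n : ℕ}
    (hab : ∀ k < n, a k = b k) :
    |cf01 a - cf01 b| = |cf01 (dropSeq n a) - cf01 (dropSeq n b)| *
      (∏ k ∈ Finset.range n, cf01 (dropSeq k a)) * ∏ k ∈ Finset.range n, cf01 (dropSeq k b) := by
  induction n with
  | zero =>
    have h : ∀ a, dropSeq 0 a = a := fun a => by funext k; simp [dropSeq]
    simp [h]
  | succ n ih =>
    rw [ih fun k hk => hab k (by omega), Finset.prod_range_succ, Finset.prod_range_succ]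
    have h₁ := cf01_pos (ha.dropSeq (n + 1))
    have h₂ := cf01_pos (hb.dropSeq (n + 1))
    have h₃ := ha.one_le n
    have e₁ := cf01_dropSeq ha n
    have e₂ := cf01_dropSeq hb n
    rw [← hab n (by omega)] at e₂
    have h₄ := cf01_pos (ha.dropSeq n)
    have h₅ := cf01_pos (hb.dropSeq n)
    have e : cf01 (dropSeq n a) - cf01 (dropSeq n b) =
        -((cf01 (dropSeq (n + 1) a) - cf01 (dropSeq (n + 1) b)) * cf01 (dropSeq n a) *
          cf01 (dropSeq n b)) := by
      rw [e₁, e₂]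
      have h₆ : (a n : ℝ) + cf01 (dropSeq (n + 1) a) ≠ 0 := by linarith
      have h₇ : (a n : ℝ) + cf01 (dropSeq (n + 1) b) ≠ 0 := by linarith
      field_simp
      ring
    rw [e, abs_neg, abs_mul, abs_mul, abs_of_pos h₄, abs_of_pos h₅]
    ring

theorem pastWord_eq_iff {a b : ℕ → ℕ} {n : ℕ} :
    pastWord a n = pastWord b n ↔ ∀ k < n, a k = b k := by
  induction n with
  | zero => simp [pastWord]
  | succ n ih =>
    simp only [pastWord, List.cons.injEq, ih]
    constructor
    · rintro ⟨h₁, h₂⟩ k hk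
      rcases Nat.lt_succ_iff_lt_or_eq.1 hk with h | rfl
      · exact h₂ k h
      · exact h₁
    · exact fun h => ⟨h n (by omega), fun k hk => h k (by omega)⟩

theorem abs_cf01_sub_le {a b : ℕ → ℕ} (ha : IsDigitSeq a) (hb : IsDigitSeq b) {n : ℕ}
    (hab : pastWord a n = pastWord b n) :
    |cf01 a - cf01 b| ≤ 3 * (wordDen (pastWord a n) ^ 2)⁻¹ := by
  have h₁ := (prod_cf01_dropSeq_bounds ha n).2
  have h₂ := (prod_cf01_dropSeq_bounds hb n).2
  rw [← hab] at h₂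
  have hQ := wordDen_pos (ha.isDigitWord n)
  have h₃ : |cf01 (dropSeq n a) - cf01 (dropSeq n b)| ≤ 1 := by
    have := cf01_pos (ha.dropSeq n)
    have := cf01_pos (hb.dropSeq n)
    have := cf01_le_one (ha.dropSeq n)
    have := cf01_le_one (hb.dropSeq n)
    rw [abs_le]
    constructor <;> linarith
  have hP : 0 ≤ ∏ k ∈ Finset.range n, cf01 (dropSeq k a) :=
    Finset.prod_nonneg fun k _ => (cf01_pos (ha.dropSeq k)).le
  have hP' : 0 ≤ ∏ k ∈ Finset.range n, cf01 (dropSeq k b) :=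
    Finset.prod_nonneg fun k _ => (cf01_pos (hb.dropSeq k)).le
  rw [cf01_sub_eq ha hb (pastWord_eq_iff.1 hab)]
  calc _ ≤ 1 * (3 / 2 / wordDen (pastWord a n)) * (3 / 2 / wordDen (pastWord a n)) := by gcongr
    _ = 9 / 4 * (wordDen (pastWord a n) ^ 2)⁻¹ := by field_simp; norm_num
    _ ≤ _ := by
      have : 0 ≤ (wordDen (pastWord a n) ^ 2)⁻¹ := by positivity
      linarith

theorem le_abs_cf01_sub {a b : ℕ → ℕ} (ha : IsDigitSeq a) (hb : IsDigitSeq b) {n : ℕ}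
    (hab : pastWord a n = pastWord b n) (hn : a n ≠ b n) :
    1 / 28 * (wordDen (pastWord a n) ^ 2)⁻¹ ≤ |cf01 a - cf01 b| := by
  have h₁ := (prod_cf01_dropSeq_bounds ha n).1
  have h₂ := (prod_cf01_dropSeq_bounds hb n).1
  rw [← hab] at h₂
  have hQ := wordDen_pos (ha.isDigitWord n)
  have h₃ := one_seventh_le_abs_cf01_sub (ha.dropSeq n) (hb.dropSeq n) (by simpa [dropSeq])
  have h₄ := mul_nonneg (abs_nonneg (cf01 (dropSeq n a) - cf01 (dropSeq n b)))
    (le_trans (by positivity) h₁)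
  rw [cf01_sub_eq ha hb (pastWord_eq_iff.1 hab)]
  calc _ = 1 / 7 * (1 / 2 / wordDen (pastWord a n)) * (1 / 2 / wordDen (pastWord a n)) := by
        field_simp; norm_num
    _ ≤ _ := by gcongr

end ContinuedFraction

section Dimension

/-- The continued fractions all of whose finite digit words (most recent digit first)
satisfy `P`. -/
def wordSet (P : List ℕ → Prop) : Set ℝ :=
  {x | ∃ a : ℕ → ℕ, (∀ n, P (pastWord a n)) ∧ x = cf01 a}

/-- The part of `wordSet P` with initial word `h`. -/
def wordCylinder (P : List ℕ → Prop) (h : List ℕ) : Set ℝ :=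
  {x | ∃ a : ℕ → ℕ, (∀ n, P (pastWord a n)) ∧ pastWord a h.length = h ∧ x = cf01 a}

/-- The words of length `n` over the alphabet `{1, 2}`. -/
def digitWords : ℕ → Finset (List ℕ)
  | 0 => {[]}
  | n + 1 => (digitWords n).image (List.cons 1) ∪ (digitWords n).image (List.cons 2)

theorem isDigitSeq_of_forall_pastWord {a : ℕ → ℕ} (ha : ∀ n, IsDigitWord (pastWord a n)) :
    IsDigitSeq a :=
  fun n => ha (n + 1) (a n) List.mem_cons_self

theorem IsDigitSeq.pastWord_mem_digitWords {a : ℕ → ℕ} (ha : IsDigitSeq a) (n : ℕ) :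
    pastWord a n ∈ digitWords n := by
  induction n with
  | zero => simp [pastWord, digitWords]
  | succ n ih =>
    simp only [digitWords, pastWord, Finset.mem_union, Finset.mem_image]
    rcases ha n with h | h
    · exact Or.inl ⟨_, ih, by rw [h]⟩
    · exact Or.inr ⟨_, ih, by rw [h]⟩

theorem length_of_mem_digitWords {n : ℕ} {h : List ℕ} (H : h ∈ digitWords n) : h.length = n := by
  induction n generalizing h with
  | zero =>
    simp only [digitWords, Finset.mem_singleton] at H
    simp [H]
  | succ n ih =>
    simp only [digitWords, Finset.mem_union, Finset.mem_image] at H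
    rcases H with ⟨l, hl, rfl⟩ | ⟨l, hl, rfl⟩ <;> simp [ih hl]

theorem sum_digitWords_le {Φ : List ℕ → ℝ} (hstep : ∀ h, Φ (1 :: h) + Φ (2 :: h) ≤ Φ h) (n : ℕ) :
    ∑ h ∈ digitWords n, Φ h ≤ Φ [] := by
  induction n with
  | zero => simp [digitWords]
  | succ n ih =>
    rw [digitWords, Finset.sum_union, Finset.sum_image, Finset.sum_image, ← Finset.sum_add_distrib]
    · exact (Finset.sum_le_sum fun h _ => hstep h).trans ih
    · intro x _ y _ h
      simpa using h
    · intro x _ y _ h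
      simpa using h
    · rw [Finset.disjoint_left]
      intro l h₁ h₂
      simp only [Finset.mem_image] at h₁ h₂
      obtain ⟨x, _, rfl⟩ := h₁
      obtain ⟨y, _, h⟩ := h₂
      simp at h

theorem ediam_wordCylinder_le {P : List ℕ → Prop} (hP : ∀ h, P h → IsDigitWord h) (h : List ℕ) :
    Metric.ediam (wordCylinder P h) ≤ ENNReal.ofReal (3 * (wordDen h ^ 2)⁻¹) := by
  refine Metric.ediam_le ?_
  rintro _ ⟨a, ha, hah, rfl⟩ _ ⟨b, hb, hbh, rfl⟩
  rw [edist_dist, Real.dist_eq]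
  have := abs_cf01_sub_le (isDigitSeq_of_forall_pastWord fun n => hP _ (ha n))
    (isDigitSeq_of_forall_pastWord fun n => hP _ (hb n)) (hah.trans hbh.symm)
  rw [hah] at this
  exact ENNReal.ofReal_le_ofReal this

/-- A supermartingale on the tree of admissible words that dominates the `t`-th power of the
diameters of the cylinders bounds the dimension from above by `t`. -/
theorem dimH_wordSet_le {P : List ℕ → Prop} (hP : ∀ h, P h → IsDigitWord h) {t : NNReal}
    (ht : 0 < t) {Φ : List ℕ → ℝ} (hΦ : ∀ h, 0 ≤ Φ h) {c : ℝ} (hc : 0 ≤ c)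
    (hbound : ∀ h, P h → ((wordDen h ^ 2)⁻¹) ^ (t : ℝ) ≤ c * Φ h)
    (hstep : ∀ h, Φ (1 :: h) + Φ (2 :: h) ≤ Φ h) : dimH (wordSet P) ≤ t := by
  have ht' : (0 : ℝ) < t := by exact_mod_cast ht
  have hdiam : ∀ h, Metric.ediam (wordCylinder P h) ^ (t : ℝ) ≤
      ENNReal.ofReal (3 ^ (t : ℝ) * c * Φ h) := by
    intro h
    rcases (wordCylinder P h).eq_empty_or_nonempty with he | ⟨_, a, ha, hah, -⟩
    · simp [he, ht']
    · have hPh : P h := hah ▸ ha h.length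
      have hQ := wordDen_pos (hP h hPh)
      calc _ ≤ ENNReal.ofReal (3 * (wordDen h ^ 2)⁻¹) ^ (t : ℝ) :=
            ENNReal.rpow_le_rpow (ediam_wordCylinder_le hP h) ht'.le
        _ = ENNReal.ofReal ((3 * (wordDen h ^ 2)⁻¹) ^ (t : ℝ)) :=
            ENNReal.ofReal_rpow_of_pos (by positivity)
        _ ≤ _ := by
          apply ENNReal.ofReal_le_ofReal
          rw [Real.mul_rpow (by norm_num) (by positivity), mul_assoc]
          exact mul_le_mul_of_nonneg_left (hbound h hPh) (by positivity)
  have hle : MeasureTheory.Measure.hausdorffMeasure (t : ℝ) (wordSet P) ≤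
      ENNReal.ofReal (3 ^ (t : ℝ) * c * Φ []) := by
    refine (MeasureTheory.Measure.hausdorffMeasure_le_liminf_sum (ι := fun n => digitWords n)
      (t : ℝ) (wordSet P) (l := atTop)
      (fun n => ENNReal.ofReal (3 * ((9 / 16) ^ n))) ?_ (fun n h => wordCylinder P h) ?_ ?_).trans
      (?_ : _ ≤ _)
    · rw [← ENNReal.ofReal_zero]
      apply ENNReal.tendsto_ofReal
      have := tendsto_pow_atTop_nhds_zero_of_lt_one (r := (9 / 16 : ℝ)) (by norm_num) (by norm_num)
      simpa using this.const_mul 3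
    · refine Eventually.of_forall fun n h => ?_
      rcases (wordCylinder P h).eq_empty_or_nonempty with he | ⟨_, a, ha, hah, -⟩
      · simp [he]
      · have hPh : P h := hah ▸ ha (h : List ℕ).length
        refine (ediam_wordCylinder_le hP h).trans (ENNReal.ofReal_le_ofReal ?_)
        have h₁ := four_thirds_pow_le_wordDen (hP h hPh)
        rw [length_of_mem_digitWords h.2] at h₁
        have h₂ : ((9 / 16 : ℝ)) ^ n = (((4 / 3 : ℝ) ^ n) ^ 2)⁻¹ := by
          rw [← pow_mul, mul_comm n 2, pow_mul, ← inv_pow]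
          norm_num
        rw [h₂]
        gcongr
    · refine Eventually.of_forall fun n => ?_
      rintro _ ⟨a, ha, rfl⟩
      have hd := isDigitSeq_of_forall_pastWord fun n => hP _ (ha n)
      exact Set.mem_iUnion.2 ⟨⟨pastWord a n, hd.pastWord_mem_digitWords n⟩,
        a, ha, by simp [length_pastWord], rfl⟩
    · refine (liminf_le_liminf (v := fun _ => ENNReal.ofReal (3 ^ (t : ℝ) * c * Φ []))
        (Eventually.of_forall fun n => ?_)).trans (by simp)
      calc _ ≤ ∑ h : digitWords n, ENNReal.ofReal (3 ^ (t : ℝ) * c * Φ h) :=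
            Finset.sum_le_sum fun h _ => hdiam h
        _ = ENNReal.ofReal (∑ h : digitWords n, 3 ^ (t : ℝ) * c * Φ h) :=
            (ENNReal.ofReal_sum_of_nonneg (f := fun h : digitWords n => 3 ^ (t : ℝ) * c * Φ h)
              fun h _ => mul_nonneg (mul_nonneg (by positivity) hc) (hΦ h)).symm
        _ ≤ _ := by
          apply ENNReal.ofReal_le_ofReal
          rw [Finset.sum_coe_sort (digitWords n) fun h => 3 ^ (t : ℝ) * c * Φ h, ← Finset.mul_sum]
          exact mul_le_mul_of_nonneg_left (sum_digitWords_le hstep n)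
            (mul_nonneg (by positivity) hc)
  exact dimH_le_of_hausdorffMeasure_ne_top (ne_top_of_le_ne_top ENNReal.ofReal_ne_top hle)

/-- If `M` is a submartingale on the tree of words and every infinite branch on which `M` does not
vanish passes through one of the words `w i`, then the total mass of these words is at least the
mass of the root. -/
theorem le_tsum_of_forall_branch {M : List ℕ → ENNReal} (hM : ∀ h, M h ≤ M (1 :: h) + M (2 :: h))
    (w : ℕ → List ℕ)
    (hw : ∀ a : ℕ → ℕ, (∀ n, M (pastWord a n) ≠ 0) → ∃ i, pastWord a (w i).length = w i) :
    M [] ≤ ∑' i, M (w i) := by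
  classical
  by_contra! hlt
  set S : List ℕ → ENNReal := fun h => ∑' i, if h <:+ w i then M (w i) else 0 with hS
  have hS_step : ∀ h, S (1 :: h) + S (2 :: h) ≤ S h := by
    intro h
    rw [hS]
    simp only
    rw [← ENNReal.tsum_add]
    refine ENNReal.tsum_le_tsum fun i => ?_
    by_cases h₁ : (1 :: h) <:+ w i
    · have h₂ : ¬ (2 :: h) <:+ w i := by
        intro h₂
        have := List.suffix_of_suffix_length_le h₁ h₂ (by simp)
        have := this.eq_of_length (by simp)
        simp at this
      simp [h₁, h₂, (List.suffix_cons 1 h).trans h₁]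
    · by_cases h₂ : (2 :: h) <:+ w i
      · simp [h₁, h₂, (List.suffix_cons 2 h).trans h₂]
      · simp [h₁, h₂]
  have hnext : ∀ h, S h < M h → ∃ d, S (d :: h) < M (d :: h) := by
    intro h hh
    by_contra! hno
    exact absurd ((hM h).trans ((add_le_add (hno 1) (hno 2)).trans (hS_step h))) (not_le.2 hh)
  choose! d hd using hnext
  let H : ℕ → List ℕ := fun n => Nat.rec [] (fun _ h => d h :: h) n
  have hH : ∀ n, S (H n) < M (H n) := by
    intro n
    induction n with
    | zero => simpa [hS, H] using hlt
    | succ n ih => exact hd _ ih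
  have hpast : ∀ n, pastWord (fun n => d (H n)) n = H n := by
    intro n
    induction n with
    | zero => rfl
    | succ n ih => rw [pastWord, ih]
  obtain ⟨i, hi⟩ := hw (fun n => d (H n)) fun n => by
    rw [hpast]
    exact (lt_of_le_of_lt bot_le (hH n)).ne'
  rw [hpast] at hi
  have h₁ := hH (w i).length
  rw [hi] at h₁
  refine absurd h₁ (not_lt.2 ?_)
  calc M (w i) = if w i <:+ w i then M (w i) else 0 := by simp
    _ ≤ S (w i) := ENNReal.le_tsum (f := fun j => if w i <:+ w j then M (w j) else 0) i

/-- Any set `U` is contained, within `wordSet P`, in a cylinder of comparable diameter, or in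
an arbitrarily small one. -/
theorem exists_word_of_set {P : List ℕ → Prop} (hP : ∀ h, P h → IsDigitWord h) {t : NNReal}
    (ht : 0 < t) {Φ : List ℕ → ℝ} (hΦP : ∀ h, ¬ P h → Φ h = 0) {C : ℝ} (hC : 0 ≤ C)
    (hbound : ∀ h, P h → Φ h ≤ C * ((wordDen h ^ 2)⁻¹) ^ (t : ℝ)) (U : Set ℝ) {ε : NNReal}
    (hε : 0 < ε) :
    ∃ w : List ℕ, (∀ a : ℕ → ℕ, (∀ n, P (pastWord a n)) → cf01 a ∈ U → pastWord a w.length = w) ∧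
      ENNReal.ofReal (Φ w) ≤
        ENNReal.ofReal (C * 28 ^ (t : ℝ)) * (⨆ _ : U.Nonempty, Metric.ediam U ^ (t : ℝ)) + ε := by
  classical
  have ht' : (0 : ℝ) < t := by exact_mod_cast ht
  have hε' : (0 : ℝ) < ε := by exact_mod_cast hε
  by_cases h₁ : ∃ n : ℕ, ∃ a b : ℕ → ℕ, (∀ n, P (pastWord a n)) ∧ (∀ n, P (pastWord b n)) ∧
      cf01 a ∈ U ∧ cf01 b ∈ U ∧ a n ≠ b n
  · obtain ⟨a, b, ha, hb, haU, hbU, hab⟩ := Nat.find_spec h₁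
    set n := Nat.find h₁ with hn
    have hmin : ∀ b : ℕ → ℕ, (∀ n, P (pastWord b n)) → cf01 b ∈ U →
        pastWord a n = pastWord b n := by
      intro b hb hbU
      rw [pastWord_eq_iff]
      intro k hk
      by_contra hne
      exact Nat.find_min h₁ hk ⟨a, b, ha, hb, haU, hbU, hne⟩
    have hda := isDigitSeq_of_forall_pastWord fun n => hP _ (ha n)
    have hdb := isDigitSeq_of_forall_pastWord fun n => hP _ (hb n)
    refine ⟨pastWord a n, fun c hc hcU => ?_, ?_⟩
    · rw [length_pastWord, hmin c hc hcU]
    · have hdist := le_abs_cf01_sub hda hdb (hmin b hb hbU) hab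
      have hQ := wordDen_pos (hda.isDigitWord n)
      have hsup : (⨆ _ : U.Nonempty, Metric.ediam U ^ (t : ℝ)) = Metric.ediam U ^ (t : ℝ) := by
        simp [show U.Nonempty from ⟨_, haU⟩]
      rw [hsup]
      have hdiam : ENNReal.ofReal (1 / 28 * (wordDen (pastWord a n) ^ 2)⁻¹) ≤ Metric.ediam U := by
        refine (ENNReal.ofReal_le_ofReal hdist).trans ?_
        rw [← Real.dist_eq, ← edist_dist]
        exact Metric.edist_le_ediam_of_mem haU hbU
      refine le_add_right ?_
      calc ENNReal.ofReal (Φ (pastWord a n))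
          ≤ ENNReal.ofReal (C * 28 ^ (t : ℝ) *
              (1 / 28 * (wordDen (pastWord a n) ^ 2)⁻¹) ^ (t : ℝ)) := by
            apply ENNReal.ofReal_le_ofReal
            rw [mul_assoc, ← Real.mul_rpow (by norm_num) (by positivity), ← mul_assoc]
            norm_num
            simpa using hbound _ (ha n)
        _ = ENNReal.ofReal (C * 28 ^ (t : ℝ)) *
              ENNReal.ofReal (1 / 28 * (wordDen (pastWord a n) ^ 2)⁻¹) ^ (t : ℝ) := by
            rw [ENNReal.ofReal_mul (by positivity), ENNReal.ofReal_rpow_of_pos (by positivity)]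
        _ ≤ _ := by gcongr
  · push Not at h₁
    by_cases h₂ : ∃ a : ℕ → ℕ, (∀ n, P (pastWord a n)) ∧ cf01 a ∈ U
    · obtain ⟨a, ha, haU⟩ := h₂
      have hda := isDigitSeq_of_forall_pastWord fun n => hP _ (ha n)
      have hlim : Tendsto (fun n : ℕ => C * ((9 / 16 : ℝ) ^ n) ^ (t : ℝ)) atTop (nhds 0) := by
        have h₃ := tendsto_pow_atTop_nhds_zero_of_lt_one (r := (9 / 16 : ℝ)) (by norm_num)
          (by norm_num)
        have h₄ := (h₃.rpow_const (p := (t : ℝ)) (Or.inr ht'.le)).const_mul C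
        simpa [Real.zero_rpow ht'.ne'] using h₄
      obtain ⟨n, hn⟩ := (hlim.eventually (gt_mem_nhds hε')).exists
      refine ⟨pastWord a n, fun b hb hbU => ?_, ?_⟩
      · rw [length_pastWord, pastWord_eq_iff]
        intro k _
        exact (h₁ k a b ha hb haU hbU).symm
      · refine le_add_left ?_
        rw [← ENNReal.ofReal_coe_nnreal]
        apply ENNReal.ofReal_le_ofReal
        refine ((hbound _ (ha n)).trans ?_).trans hn.le
        have h₅ := four_thirds_pow_le_wordDen (hda.isDigitWord n)
        rw [length_pastWord] at h₅
        have h₆ : ((9 / 16 : ℝ)) ^ n = (((4 / 3 : ℝ) ^ n) ^ 2)⁻¹ := by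
          rw [← pow_mul, mul_comm n 2, pow_mul, ← inv_pow]
          norm_num
        rw [h₆]
        have hQ := wordDen_pos (hda.isDigitWord n)
        gcongr
    · refine ⟨[0], fun a ha haU => absurd ⟨a, ha, haU⟩ h₂, ?_⟩
      have : ¬ P [0] := fun h => by simpa using hP _ h 0 (by simp)
      simp [hΦP _ this]

/-- A nontrivial submartingale on the tree of admissible words that is dominated by the `t`-th
power of the diameters of the cylinders bounds the dimension from below by `t`. -/
theorem le_dimH_wordSet {P : List ℕ → Prop} (hP : ∀ h, P h → IsDigitWord h) {t : NNReal}
    (ht : 0 < t) {Φ : List ℕ → ℝ} (hΦ : ∀ h, 0 ≤ Φ h) (hΦP : ∀ h, ¬ P h → Φ h = 0) {C : ℝ}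
    (hC : 0 < C) (hbound : ∀ h, P h → Φ h ≤ C * ((wordDen h ^ 2)⁻¹) ^ (t : ℝ))
    (hstep : ∀ h, Φ h ≤ Φ (1 :: h) + Φ (2 :: h)) (hroot : 0 < Φ []) :
    (t : ENNReal) ≤ dimH (wordSet P) := by
  apply le_dimH_of_hausdorffMeasure_ne_zero
  set K : ENNReal := ENNReal.ofReal (C * 28 ^ (t : ℝ)) with hK
  set m : ENNReal := ENNReal.ofReal (Φ []) with hm
  have hm0 : 0 < m := ENNReal.ofReal_pos.2 hroot
  have hmtop : m ≠ ⊤ := ENNReal.ofReal_ne_top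
  have hK0 : K ≠ 0 := (ENNReal.ofReal_pos.2 (by positivity)).ne'
  have hKtop : K ≠ ⊤ := ENNReal.ofReal_ne_top
  have hpos : 0 < m / 2 / K := ENNReal.div_pos (ENNReal.half_pos hm0.ne').ne' hKtop
  refine (lt_of_lt_of_le hpos ?_).ne'
  rw [MeasureTheory.Measure.hausdorffMeasure_apply]
  refine le_iSup₂_of_le 1 one_pos ?_
  refine le_iInf fun U => le_iInf fun hU => le_iInf fun _ => ?_
  obtain ⟨ε, hε, hεsum⟩ := ENNReal.exists_pos_sum_of_countable
    (ENNReal.half_pos hm0.ne').ne' ℕ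
  choose w hw₁ hw₂ using fun i => exists_word_of_set hP ht hΦP hC.le hbound (U i) (hε i)
  have hsum : m ≤ ∑' i, ENNReal.ofReal (Φ (w i)) := by
    refine le_tsum_of_forall_branch (M := fun h => ENNReal.ofReal (Φ h)) (fun h => ?_) w
      fun a ha => ?_
    · rw [← ENNReal.ofReal_add (hΦ _) (hΦ _)]
      exact ENNReal.ofReal_le_ofReal (hstep h)
    · have hPa : ∀ n, P (pastWord a n) := fun n => by
        by_contra h
        exact ha n (by simp [hΦP _ h])
      obtain ⟨i, hi⟩ := Set.mem_iUnion.1 (hU ⟨a, hPa, rfl⟩)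
      exact ⟨i, hw₁ i a hPa hi⟩
  have hle : m ≤ K * (∑' i, ⨆ _ : (U i).Nonempty, Metric.ediam (U i) ^ (t : ℝ)) + m / 2 := by
    calc m ≤ _ := hsum
      _ ≤ ∑' i, (K * (⨆ _ : (U i).Nonempty, Metric.ediam (U i) ^ (t : ℝ)) + ε i) :=
          ENNReal.tsum_le_tsum hw₂
      _ = K * (∑' i, ⨆ _ : (U i).Nonempty, Metric.ediam (U i) ^ (t : ℝ)) +
            ∑' i, (ε i : ENNReal) := by
          rw [ENNReal.tsum_add, ENNReal.tsum_mul_left]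
      _ ≤ _ := by gcongr
  rw [ENNReal.div_le_iff hK0 hKtop, mul_comm]
  have hhalf : m / 2 ≠ ⊤ := (ENNReal.div_lt_top hmtop (by norm_num)).ne
  refine (ENNReal.add_le_add_iff_right hhalf).1 ?_
  rwa [ENNReal.add_halves]

end Dimension

section Automaton

/-- Structurally recursive Boolean test for initial segments, suited to evaluation by the kernel. -/
def isPrefixWord : List ℕ → List ℕ → Bool
  | [], _ => true
  | _ :: _, [] => false
  | a :: l, b :: m => Nat.beq a b && isPrefixWord l m

theorem isPrefixWord_iff {l m : List ℕ} : isPrefixWord l m = true ↔ l <+: m := by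
  induction l generalizing m with
  | nil => simp [isPrefixWord]
  | cons a l ih => cases m <;> simp [isPrefixWord, ih, List.cons_prefix_cons]

/-- A state of the automaton recognising the words that avoid the forbidden words. The state is
named by the relevant past `word` (most recent digit first). It carries an interval
`[lo, hi] / 10 ^ 4` for the ratio of consecutive denominators and the test function
`r ↦ A / (r + B / 10 ^ 4)` on that interval. -/
structure StateRow where
  word : List ℕ
  lo : ℕ
  hi : ℕ
  A : ℕ
  B : ℕ

/-- The forbidden words together with their reverses. -/
def forbiddenSym : List (List ℕ) := forbiddenB2 ++ forbiddenB2.map List.reverse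

/-- The states, ordered by decreasing length of the relevant past. -/
def stateRows : List StateRow :=
  [⟨[2, 1, 2, 2, 1, 1, 1, 2, 1, 2, 2, 1, 1, 1, 1, 1, 1], 3697, 3699, 61152750, 16647⟩,
   ⟨[2, 1, 1, 1, 2, 2, 1, 2, 1, 1, 1, 2, 2, 1, 1, 1, 1], 3802, 3803, 79292301, 16261⟩,
   ⟨[1, 1, 1, 2, 2, 1, 1, 1, 2, 1, 2, 2, 1, 1, 1, 2, 2], 6301, 6303, 90864805, 25013⟩,
   ⟨[1, 1, 1, 1, 1, 2, 2, 1, 2, 1, 1, 1, 2, 2, 1, 2, 2], 6197, 6199, 99973297, 25182⟩,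
   ⟨[1, 2, 2, 1, 1, 1, 2, 1, 2, 2, 1, 1, 1, 1, 1, 1], 7040, 7042, 36737350, 26008⟩,
   ⟨[1, 1, 1, 2, 2, 1, 2, 1, 1, 1, 2, 2, 1, 1, 1, 1], 6300, 6301, 48765961, 26151⟩,
   ⟨[1, 1, 2, 2, 1, 1, 1, 2, 1, 2, 2, 1, 1, 1, 2, 2], 5867, 5869, 36329621, 13999⟩,
   ⟨[1, 1, 1, 1, 2, 2, 1, 2, 1, 1, 1, 2, 2, 1, 2, 2], 6134, 6135, 39702794, 13972⟩,
   ⟨[2, 2, 2, 1, 1, 2, 1, 2, 1, 1, 1, 1, 2, 2, 2, 2], 4134, 4135, 103866344, 15617⟩,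
   ⟨[2, 2, 2, 1, 1, 1, 1, 2, 1, 2, 1, 1, 2, 2, 2, 2], 4132, 4133, 103866344, 15617⟩,
   ⟨[2, 2, 1, 1, 1, 2, 1, 2, 2, 1, 1, 1, 1, 1, 1], 4202, 4203, 14126392, 13846⟩,
   ⟨[1, 1, 2, 2, 1, 2, 1, 1, 1, 2, 2, 1, 1, 1, 1], 5871, 5873, 18649153, 13825⟩,
   ⟨[1, 2, 2, 1, 1, 1, 2, 1, 2, 2, 1, 1, 1, 2, 2], 7040, 7042, 104677645, 22065⟩,
   ⟨[1, 1, 1, 2, 2, 1, 2, 1, 1, 1, 2, 2, 1, 2, 2], 6300, 6301, 118388964, 22238⟩,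
   ⟨[2, 2, 1, 1, 2, 1, 2, 1, 1, 1, 1, 2, 2, 2, 2], 4187, 4188, 66514409, 26405⟩,
   ⟨[2, 2, 1, 1, 1, 1, 2, 1, 2, 1, 1, 2, 2, 2, 2], 4196, 4197, 66514409, 26405⟩,
   ⟨[2, 1, 1, 1, 2, 1, 2, 2, 1, 1, 1, 1, 1, 1], 3796, 3798, 10203390, 27224⟩,
   ⟨[1, 2, 2, 1, 2, 1, 1, 1, 2, 2, 1, 1, 1, 1], 7029, 7031, 95534300, 23194⟩,
   ⟨[1, 2, 2, 1, 1, 1, 2, 1, 2, 2, 1, 1, 1, 1], 7040, 7042, 80398492, 24821⟩,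
   ⟨[1, 1, 1, 2, 2, 1, 2, 1, 1, 1, 2, 2, 1, 1], 6300, 6301, 92035328, 25036⟩,
   ⟨[2, 2, 1, 1, 1, 2, 1, 2, 2, 1, 1, 1, 2, 2], 4202, 4203, 47443563, 14533⟩,
   ⟨[1, 1, 2, 2, 1, 2, 1, 1, 1, 2, 2, 1, 2, 2], 5871, 5873, 53241256, 14498⟩,
   ⟨[2, 1, 1, 2, 1, 2, 1, 1, 1, 1, 2, 2, 2, 2], 3879, 3880, 123071164, 16612⟩,
   ⟨[2, 1, 1, 1, 1, 2, 1, 2, 1, 1, 2, 2, 2, 2], 3828, 3829, 120559667, 16690⟩,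
   ⟨[1, 1, 1, 2, 1, 2, 2, 1, 1, 1, 1, 1, 1], 6336, 6338, 116765814, 15558⟩,
   ⟨[2, 2, 1, 2, 1, 1, 1, 2, 2, 1, 1, 1, 1], 4224, 4225, 41190964, 14312⟩,
   ⟨[2, 2, 1, 1, 1, 2, 1, 2, 2, 1, 1, 1, 1], 4202, 4203, 32393786, 14030⟩,
   ⟨[1, 1, 2, 2, 1, 2, 1, 1, 1, 2, 2, 1, 1], 5871, 5873, 36763210, 13995⟩,
   ⟨[1, 1, 2, 2, 1, 1, 1, 2, 1, 2, 2, 1, 1], 5867, 5869, 108917843, 15522⟩,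
   ⟨[2, 1, 1, 2, 1, 2, 1, 1, 1, 1, 2, 2, 1], 3879, 3880, 99786698, 15704⟩,
   ⟨[2, 1, 1, 1, 1, 2, 1, 2, 1, 1, 2, 2, 1], 3828, 3829, 97246617, 15764⟩,
   ⟨[1, 2, 2, 1, 2, 1, 1, 1, 2, 2, 1, 1, 2], 7029, 7031, 83083390, 24865⟩,
   ⟨[2, 2, 1, 1, 2, 1, 2, 1, 1, 1, 1, 2, 2], 4187, 4188, 109550177, 25337⟩,
   ⟨[2, 1, 1, 1, 2, 1, 2, 2, 1, 1, 1, 2, 2], 3796, 3798, 32647620, 26882⟩,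
   ⟨[2, 2, 1, 1, 1, 1, 2, 1, 2, 1, 1, 2, 2], 4196, 4197, 109550177, 25337⟩,
   ⟨[1, 2, 2, 1, 2, 1, 1, 1, 2, 2, 1, 2, 2], 7029, 7031, 117530267, 21361⟩,
   ⟨[1, 1, 2, 1, 2, 1, 1, 1, 1, 2, 2, 2, 2], 5775, 5777, 74091196, 26021⟩,
   ⟨[1, 1, 1, 1, 2, 1, 2, 1, 1, 2, 2, 2, 2], 6119, 6121, 72240337, 25993⟩,
   ⟨[1, 1, 2, 1, 2, 2, 1, 1, 1, 1, 1, 1], 5780, 5781, 176622692, 20157⟩,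
   ⟨[2, 1, 2, 1, 1, 1, 2, 2, 1, 1, 1, 1], 3670, 3671, 28782431, 26988⟩,
   ⟨[2, 1, 1, 1, 2, 1, 2, 2, 1, 1, 1, 1], 3796, 3798, 23090734, 27129⟩,
   ⟨[1, 2, 2, 1, 2, 1, 1, 1, 2, 2, 1, 1], 7029, 7031, 107626177, 22125⟩,
   ⟨[1, 2, 2, 1, 1, 1, 2, 1, 2, 2, 1, 1], 7040, 7042, 147150251, 19658⟩,
   ⟨[1, 1, 2, 1, 2, 1, 1, 1, 1, 2, 2, 1], 5775, 5777, 63546787, 26369⟩,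
   ⟨[1, 1, 1, 1, 2, 1, 2, 1, 1, 2, 2, 1], 6119, 6121, 61693943, 26345⟩,
   ⟨[1, 1, 1, 2, 1, 2, 2, 1, 1, 1, 1, 2], 6336, 6338, 113296937, 15417⟩,
   ⟨[1, 1, 1, 1, 2, 2, 1, 2, 1, 1, 1, 2], 6134, 6135, 111521157, 15448⟩,
   ⟨[2, 2, 1, 2, 1, 1, 1, 2, 2, 1, 1, 2], 4224, 4225, 33416572, 14023⟩,
   ⟨[2, 1, 1, 2, 1, 2, 1, 1, 1, 1, 2, 2], 3879, 3880, 139905091, 17161⟩,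
   ⟨[1, 1, 1, 2, 1, 2, 2, 1, 1, 1, 2, 2], 6336, 6338, 124562117, 15858⟩,
   ⟨[2, 1, 1, 1, 1, 2, 1, 2, 1, 1, 2, 2], 3828, 3829, 137416272, 17247⟩,
   ⟨[2, 2, 1, 2, 1, 1, 1, 2, 2, 1, 2, 2], 4224, 4225, 55023333, 14682⟩,
   ⟨[1, 2, 1, 2, 1, 1, 1, 1, 2, 2, 2, 2], 7313, 7315, 28475469, 13844⟩,
   ⟨[1, 1, 1, 2, 1, 2, 1, 1, 2, 2, 2, 2], 6338, 6340, 27793844, 13848⟩,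
   ⟨[1, 2, 1, 2, 2, 1, 1, 1, 1, 1, 1], 7300, 7301, 87628981, 14962⟩,
   ⟨[1, 2, 1, 1, 1, 2, 2, 1, 1, 1, 1], 7244, 7246, 121262689, 15769⟩,
   ⟨[1, 1, 1, 2, 1, 2, 2, 1, 1, 1, 1], 6336, 6338, 121183223, 15730⟩,
   ⟨[2, 2, 1, 2, 1, 1, 1, 2, 2, 1, 1], 4224, 4225, 48648412, 14521⟩,
   ⟨[2, 2, 1, 1, 1, 2, 1, 2, 2, 1, 1], 4202, 4203, 74860043, 15088⟩,
   ⟨[1, 2, 1, 2, 1, 1, 1, 1, 2, 2, 1], 7313, 7315, 24100299, 13793⟩,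
   ⟨[1, 1, 1, 2, 1, 2, 1, 1, 2, 2, 1], 6338, 6340, 23419538, 13797⟩,
   ⟨[1, 1, 2, 1, 2, 2, 1, 1, 1, 1, 2], 5780, 5781, 175182323, 20248⟩,
   ⟨[1, 1, 1, 2, 2, 1, 2, 1, 1, 1, 2], 6300, 6301, 160128131, 19920⟩,
   ⟨[2, 1, 2, 1, 1, 1, 2, 2, 1, 1, 2], 3670, 3671, 23832022, 27133⟩,
   ⟨[1, 1, 2, 1, 2, 1, 1, 1, 1, 2, 2], 5775, 5777, 81532583, 25829⟩,
   ⟨[1, 1, 2, 1, 2, 2, 1, 1, 1, 2, 2], 5780, 5781, 179856129, 19963⟩,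
   ⟨[1, 1, 1, 1, 2, 1, 2, 1, 1, 2, 2], 6119, 6121, 79682987, 25800⟩,
   ⟨[2, 1, 2, 1, 1, 1, 2, 2, 1, 2, 2], 3670, 3671, 37479067, 26812⟩,
   ⟨[1, 2, 2, 1, 2, 1, 1, 1, 2, 2, 2], 7029, 7031, 83083390, 24865⟩,
   ⟨[2, 1, 2, 1, 1, 1, 1, 2, 2, 2, 2], 3672, 3673, 129255319, 23214⟩,
   ⟨[1, 1, 2, 1, 2, 1, 1, 2, 2, 2, 2], 5775, 5777, 124824503, 23231⟩,
   ⟨[2, 1, 2, 2, 1, 1, 1, 1, 1, 1], 3697, 3698, 164362653, 20867⟩,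
   ⟨[2, 1, 1, 1, 2, 2, 1, 1, 1, 1], 3801, 3803, 180604550, 19994⟩,
   ⟨[1, 1, 2, 1, 2, 2, 1, 1, 1, 1], 5780, 5781, 178455860, 20045⟩,
   ⟨[2, 1, 2, 1, 1, 1, 2, 2, 1, 1], 3670, 3671, 33504726, 26888⟩,
   ⟨[2, 1, 1, 1, 2, 1, 2, 2, 1, 1], 3796, 3798, 49619178, 26629⟩,
   ⟨[2, 1, 2, 1, 1, 1, 1, 2, 2, 1], 3672, 3673, 126440180, 23471⟩,
   ⟨[1, 1, 2, 1, 2, 1, 1, 2, 2, 1], 5775, 5777, 121965308, 23488⟩,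
   ⟨[1, 2, 1, 2, 2, 1, 1, 1, 1, 2], 7300, 7301, 86524901, 14940⟩,
   ⟨[1, 1, 2, 2, 1, 2, 1, 1, 1, 2], 5871, 5873, 80390510, 15021⟩,
   ⟨[1, 2, 1, 1, 1, 2, 2, 1, 1, 2], 7245, 7246, 119508399, 15700⟩,
   ⟨[1, 1, 1, 2, 1, 2, 2, 1, 1, 2], 6336, 6338, 113296937, 15417⟩,
   ⟨[1, 2, 1, 2, 1, 1, 1, 1, 2, 2], 7313, 7315, 31568992, 13873⟩,
   ⟨[1, 2, 1, 2, 2, 1, 1, 1, 2, 2], 7299, 7301, 90099512, 15010⟩,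
   ⟨[1, 1, 1, 2, 1, 2, 1, 1, 2, 2], 6338, 6340, 30887011, 13877⟩,
   ⟨[1, 2, 1, 1, 1, 2, 2, 1, 2, 2], 7244, 7246, 124358233, 15888⟩,
   ⟨[2, 2, 1, 2, 1, 1, 1, 2, 2, 2], 4224, 4225, 33416572, 14023⟩,
   ⟨[1, 2, 1, 1, 1, 1, 2, 2, 2, 2], 7232, 7233, 163457678, 17191⟩,
   ⟨[1, 2, 1, 2, 1, 1, 2, 2, 2, 2], 7312, 7314, 53736448, 14306⟩,
   ⟨[1, 2, 2, 1, 1, 1, 1, 1, 1], 7042, 7044, 185213733, 17821⟩,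
   ⟨[1, 1, 1, 2, 2, 1, 1, 1, 1], 6301, 6303, 196783515, 18101⟩,
   ⟨[1, 2, 1, 2, 2, 1, 1, 1, 1], 7300, 7301, 89034301, 14990⟩,
   ⟨[1, 2, 1, 1, 1, 2, 2, 1, 1], 7244, 7246, 122940292, 15834⟩,
   ⟨[1, 1, 1, 2, 1, 2, 2, 1, 1], 6336, 6338, 130613788, 16077⟩,
   ⟨[1, 2, 1, 1, 1, 1, 2, 2, 1], 7232, 7233, 161767417, 17138⟩,
   ⟨[1, 2, 1, 2, 1, 1, 2, 2, 1], 7312, 7314, 51931320, 14259⟩,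
   ⟨[2, 1, 2, 2, 1, 1, 1, 1, 2], 3697, 3698, 163755246, 20899⟩,
   ⟨[1, 2, 2, 1, 2, 1, 1, 1, 2], 7029, 7031, 133642567, 20444⟩,
   ⟨[2, 1, 1, 1, 2, 2, 1, 1, 2], 3801, 3802, 179899113, 20039⟩,
   ⟨[1, 1, 2, 1, 2, 2, 1, 1, 2], 5779, 5781, 175182323, 20248⟩,
   ⟨[2, 1, 2, 1, 1, 1, 1, 2, 2], 3672, 3673, 131255187, 23044⟩,
   ⟨[2, 1, 2, 2, 1, 1, 1, 2, 2], 3697, 3699, 165729816, 20798⟩,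
   ⟨[1, 1, 2, 1, 2, 1, 1, 2, 2], 5775, 5777, 126858126, 23062⟩,
   ⟨[2, 1, 1, 1, 2, 2, 1, 2, 2], 3801, 3803, 181853978, 19917⟩,
   ⟨[2, 1, 2, 1, 1, 1, 2, 2, 2], 3670, 3671, 23832022, 27133⟩,
   ⟨[2, 1, 1, 1, 1, 2, 2, 2, 2], 3826, 3827, 196944218, 19085⟩,
   ⟨[2, 1, 2, 1, 1, 2, 2, 2, 2], 3674, 3676, 144852105, 22006⟩,
   ⟨[2, 2, 1, 1, 1, 1, 1, 1], 4197, 4199, 205435834, 18741⟩,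
   ⟨[2, 1, 2, 1, 1, 1, 1, 1], 3671, 3672, 110978344, 25356⟩,
   ⟨[1, 1, 2, 2, 1, 1, 1, 1], 5866, 5868, 207401865, 18595⟩,
   ⟨[2, 1, 2, 2, 1, 1, 1, 1], 3697, 3698, 165142018, 20828⟩,
   ⟨[1, 1, 2, 1, 2, 1, 1, 1], 5775, 5777, 106595885, 25297⟩,
   ⟨[2, 1, 1, 1, 2, 2, 1, 1], 3801, 3803, 181281409, 19952⟩,
   ⟨[1, 1, 2, 1, 2, 2, 1, 1], 5780, 5781, 182361896, 19822⟩,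
   ⟨[1, 1, 1, 1, 2, 1, 2, 1], 6119, 6121, 104770104, 25267⟩,
   ⟨[2, 1, 1, 1, 1, 2, 2, 1], 3826, 3827, 196301342, 19116⟩,
   ⟨[2, 1, 2, 1, 1, 2, 2, 1], 3674, 3675, 143806633, 22082⟩,
   ⟨[1, 2, 2, 1, 1, 1, 1, 2], 7043, 7045, 184832273, 17811⟩,
   ⟨[2, 2, 1, 2, 1, 1, 1, 2], 4224, 4225, 65372930, 14892⟩,
   ⟨[1, 1, 1, 2, 2, 1, 1, 2], 6302, 6304, 196263398, 18087⟩,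
   ⟨[1, 2, 1, 2, 2, 1, 1, 2], 7300, 7302, 86524901, 14940⟩,
   ⟨[1, 2, 1, 1, 1, 1, 2, 2], 7232, 7233, 164652481, 17228⟩,
   ⟨[1, 2, 2, 1, 1, 1, 2, 2], 7041, 7042, 186218820, 17844⟩,
   ⟨[1, 2, 1, 2, 1, 1, 2, 2], 7312, 7314, 55010726, 14337⟩,
   ⟨[1, 1, 1, 2, 2, 1, 2, 2], 6300, 6302, 197687016, 18124⟩,
   ⟨[1, 2, 1, 1, 1, 2, 2, 2], 7245, 7246, 119508399, 15700⟩,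
   ⟨[1, 1, 1, 2, 1, 2, 2, 2], 6336, 6338, 113296937, 15417⟩,
   ⟨[1, 1, 1, 1, 2, 2, 2, 2], 6132, 6134, 207727903, 18430⟩,
   ⟨[1, 2, 1, 1, 2, 2, 2, 2], 7210, 7212, 172928401, 17476⟩,
   ⟨[2, 1, 1, 1, 1, 1, 1], 3819, 3822, 192830405, 19300⟩,
   ⟨[1, 2, 1, 1, 1, 1, 1], 7234, 7238, 152362373, 16833⟩,
   ⟨[1, 2, 2, 1, 1, 1, 1], 7042, 7044, 185700783, 17834⟩,
   ⟨[1, 2, 1, 2, 1, 1, 1], 7313, 7316, 42140513, 13954⟩,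
   ⟨[1, 1, 1, 2, 2, 1, 1], 6301, 6303, 197277446, 18114⟩,
   ⟨[1, 2, 1, 2, 2, 1, 1], 7299, 7301, 92006127, 15046⟩,
   ⟨[1, 2, 1, 1, 1, 2, 1], 7246, 7248, 111337794, 15364⟩,
   ⟨[1, 1, 1, 2, 1, 2, 1], 6338, 6340, 41468532, 13959⟩,
   ⟨[1, 1, 1, 1, 2, 2, 1], 6133, 6135, 207262484, 18419⟩,
   ⟨[1, 2, 1, 1, 2, 2, 1], 7211, 7213, 172276448, 17457⟩,
   ⟨[2, 2, 1, 1, 1, 1, 2], 4196, 4198, 205289967, 18747⟩,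
   ⟨[2, 1, 2, 1, 1, 1, 2], 3670, 3671, 43900830, 26716⟩,
   ⟨[1, 1, 2, 2, 1, 1, 2], 5865, 5867, 207212192, 18603⟩,
   ⟨[2, 1, 2, 2, 1, 1, 2], 3696, 3698, 163755246, 20899⟩,
   ⟨[2, 1, 1, 1, 2, 1, 2], 3796, 3798, 110128533, 25345⟩,
   ⟨[2, 1, 1, 1, 1, 2, 2], 3826, 3827, 197396163, 19063⟩,
   ⟨[2, 2, 1, 1, 1, 2, 2], 4201, 4202, 205842417, 18726⟩,
   ⟨[2, 1, 2, 1, 1, 2, 2], 3674, 3676, 145595218, 21954⟩,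
   ⟨[1, 1, 2, 2, 1, 2, 2], 5870, 5872, 207744603, 18582⟩,
   ⟨[2, 1, 1, 1, 2, 2, 2], 3801, 3802, 179899113, 20039⟩,
   ⟨[1, 1, 2, 1, 2, 2, 2], 5779, 5781, 175182323, 20248⟩,
   ⟨[1, 1, 1, 2, 2, 2, 2], 6305, 6307, 196441971, 18081⟩,
   ⟨[2, 1, 1, 2, 2, 2, 2], 3867, 3868, 200502583, 18918⟩,
   ⟨[1, 1, 1, 1, 1, 1], 6171, 6184, 204667690, 18357⟩,
   ⟨[2, 1, 1, 1, 1, 1], 3816, 3819, 192971020, 19304⟩,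
   ⟨[2, 2, 1, 1, 1, 1], 4197, 4199, 205617525, 18733⟩,
   ⟨[2, 1, 2, 1, 1, 1], 3670, 3673, 138131413, 22527⟩,
   ⟨[1, 1, 2, 2, 1, 1], 5866, 5869, 207588134, 18588⟩,
   ⟨[2, 1, 2, 2, 1, 1], 3697, 3699, 166791297, 20747⟩,
   ⟨[2, 1, 1, 1, 2, 1], 3797, 3799, 176774685, 20261⟩,
   ⟨[1, 1, 2, 1, 2, 1], 5774, 5777, 133836547, 22546⟩,
   ⟨[1, 1, 1, 2, 2, 1], 6300, 6302, 198364647, 18142⟩,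
   ⟨[2, 1, 1, 2, 2, 1], 3865, 3867, 200253605, 18929⟩,
   ⟨[2, 1, 1, 1, 1, 2], 3827, 3829, 198944638, 18990⟩,
   ⟨[1, 2, 1, 1, 1, 2], 7244, 7247, 126654798, 15974⟩,
   ⟨[1, 2, 2, 1, 1, 2], 7046, 7049, 184678814, 17811⟩,
   ⟨[1, 1, 1, 2, 1, 2], 6336, 6339, 153872414, 16826⟩,
   ⟨[1, 1, 1, 1, 2, 2], 6131, 6134, 208058891, 18438⟩,
   ⟨[2, 1, 1, 1, 2, 2], 3801, 3803, 182786736, 19862⟩,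
   ⟨[1, 2, 1, 1, 2, 2], 7210, 7212, 173386552, 17489⟩,
   ⟨[1, 2, 2, 1, 2, 2], 7031, 7033, 189517269, 17928⟩,
   ⟨[1, 1, 1, 2, 2, 2], 6305, 6308, 196570014, 18077⟩,
   ⟨[1, 2, 1, 2, 2, 2], 7301, 7304, 86524901, 14940⟩,
   ⟨[1, 1, 2, 2, 2, 2], 5857, 5859, 207524618, 18606⟩,
   ⟨[1, 1, 1, 1, 1], 6190, 6204, 204727848, 18359⟩,
   ⟨[2, 1, 1, 1, 1], 3823, 3824, 199177391, 18995⟩,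
   ⟨[1, 2, 1, 1, 1], 7231, 7242, 168725053, 17351⟩,
   ⟨[1, 2, 2, 1, 1], 7040, 7046, 186883425, 17862⟩,
   ⟨[1, 1, 1, 2, 1], 6323, 6334, 194658704, 18001⟩,
   ⟨[1, 2, 1, 2, 1], 7312, 7318, 59364446, 14436⟩,
   ⟨[1, 1, 2, 2, 1], 5869, 5873, 208003332, 18573⟩,
   ⟨[1, 1, 1, 1, 2], 6120, 6130, 209194561, 18466⟩,
   ⟨[2, 1, 1, 1, 2], 3799, 3801, 182966630, 19866⟩,
   ⟨[2, 2, 1, 1, 2], 4187, 4191, 205199127, 18748⟩,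
   ⟨[1, 1, 2, 1, 2], 5777, 5781, 191898474, 19338⟩,
   ⟨[1, 1, 1, 2, 2], 6303, 6305, 198663327, 18131⟩,
   ⟨[2, 1, 1, 2, 2], 3866, 3868, 200676297, 18910⟩,
   ⟨[2, 2, 1, 2, 2], 4219, 4221, 207116021, 18676⟩,
   ⟨[1, 1, 2, 2, 2], 5855, 5858, 207744398, 18608⟩,
   ⟨[2, 1, 2, 2, 2], 3692, 3695, 163755246, 20899⟩,
   ⟨[1, 2, 2, 2, 2], 7069, 7072, 184834967, 17809⟩,
   ⟨[1, 1, 1, 1], 6153, 6155, 209298100, 18469⟩,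
   ⟨[2, 1, 1, 1], 3809, 3810, 199502318, 19002⟩,
   ⟨[2, 2, 1, 1], 4193, 4203, 206087028, 18715⟩,
   ⟨[1, 1, 2, 1], 5789, 5813, 207604840, 18648⟩,
   ⟨[2, 1, 2, 1], 3666, 3676, 148135214, 21783⟩,
   ⟨[1, 2, 2, 1], 7029, 7038, 189718224, 17928⟩,
   ⟨[1, 1, 1, 2], 6315, 6316, 199163259, 18118⟩,
   ⟨[2, 1, 1, 2], 3870, 3880, 201270045, 18883⟩,
   ⟨[1, 2, 1, 2], 7299, 7308, 99239560, 15172⟩,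
   ⟨[1, 1, 2, 2], 5861, 5863, 208535154, 18578⟩,
   ⟨[2, 1, 2, 2], 3695, 3700, 170799826, 20559⟩,
   ⟨[1, 2, 2, 2], 7072, 7079, 184940919, 17807⟩,
   ⟨[2, 2, 2, 2], 4141, 4145, 205224042, 18742⟩,
   ⟨[1, 1, 1], 6249, 6251, 211200627, 18415⟩,
   ⟨[2, 1, 1], 3846, 3847, 201877707, 18896⟩,
   ⟨[1, 2, 1], 7204, 7274, 174977992, 17537⟩,
   ⟨[2, 2, 1], 4210, 4226, 207227550, 18674⟩,
   ⟨[1, 1, 2], 5833, 5834, 209305513, 18583⟩,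
   ⟨[2, 1, 2], 3684, 3685, 170857779, 20559⟩,
   ⟨[1, 2, 2], 7058, 7060, 189973432, 17923⟩,
   ⟨[2, 2, 2], 4127, 4139, 205284676, 18740⟩,
   ⟨[1, 1], 5999, 6001, 214155757, 18430⟩,
   ⟨[2, 1], 3749, 3751, 202605024, 18907⟩,
   ⟨[1, 2], 7142, 7143, 190408532, 17920⟩,
   ⟨[2, 2], 4166, 4167, 207362316, 18668⟩,
   ⟨[1], 6666, 6667, 216292537, 18445⟩,
   ⟨[2], 4000, 4000, 208941356, 18685⟩,
   ⟨[], 5000, 5000, 220742284, 18417⟩]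

/-- The state reached after reading the word `h` (most recent digit first). -/
def stateOf (h : List ℕ) : Option StateRow :=
  stateRows.find? fun ρ => isPrefixWord ρ.word h

/-- A forbidden word ends at the most recent digit of `h`. -/
def isBad (h : List ℕ) : Bool := forbiddenSym.any fun v => isPrefixWord v h

/-- The state reached from `ρ` by reading the digit `a`, if this completes no forbidden word. -/
def nextState (ρ : StateRow) (a : ℕ) : Option StateRow :=
  if isBad (a :: ρ.word) then none else stateOf (a :: ρ.word)

/-- The word `l` names a state. -/
def isStateWord (l : List ℕ) : Bool :=
  stateRows.any fun ρ => isPrefixWord ρ.word l && isPrefixWord l ρ.word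

/-- The words of consecutive rows have non-increasing lengths. -/
def isLengthDecreasing : List StateRow → Bool
  | [] => true
  | [_] => true
  | ρ :: τ :: l => Nat.ble τ.word.length ρ.word.length && isLengthDecreasing (τ :: l)

/-- The denominator `10 ^ 8 * (1 + B / 10 ^ 4 * (a + r))` at `r = R / 10 ^ 4`. -/
def denomAt (B a R : ℕ) : ℕ := 10 ^ 8 + B * (a * 10 ^ 4 + R)

/-- The polarised left side of the cleared transfer inequality. -/
def lhsAt (B c₁ c₂ B₁ B₂ u v : ℕ) : ℕ := (u + B) * (c₁ * denomAt B₂ 2 v + c₂ * denomAt B₁ 1 v)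

/-- The polarised right side of the cleared transfer inequality. -/
def rhsAt (A B₁ B₂ u v : ℕ) : ℕ := A * 10 ^ 10 * denomAt B₁ 1 u * denomAt B₂ 2 v

/-- `10 ^ 10` times an upper bound for `(a + r) ^ (12 / 10 ^ 6)`. -/
def upperWeight (a hi : ℕ) : ℕ := 10 ^ 10 + 12 * ((a - 1) * 10 ^ 4 + hi)

/-- `10 ^ 10` times a lower bound for `(a + r) ^ (48 / 10 ^ 6)`. -/
def lowerWeight (a lo : ℕ) : ℕ :=
  10 ^ 10 + 960000 * ((a - 1) * 10 ^ 4 + lo) / ((a - 1) * 10 ^ 4 + lo + 20000)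

/-- The Bernstein coefficients of `rhsAt - lhsAt` on the interval of `ρ` are nonnegative. -/
def checkUpper (ρ : StateRow) (c₁ c₂ B₁ B₂ : ℕ) : Bool :=
  Nat.ble (lhsAt ρ.B c₁ c₂ B₁ B₂ ρ.lo ρ.lo) (rhsAt ρ.A B₁ B₂ ρ.lo ρ.lo) &&
  Nat.ble (lhsAt ρ.B c₁ c₂ B₁ B₂ ρ.lo ρ.hi + lhsAt ρ.B c₁ c₂ B₁ B₂ ρ.hi ρ.lo)
    (rhsAt ρ.A B₁ B₂ ρ.lo ρ.hi + rhsAt ρ.A B₁ B₂ ρ.hi ρ.lo) &&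
  Nat.ble (lhsAt ρ.B c₁ c₂ B₁ B₂ ρ.hi ρ.hi) (rhsAt ρ.A B₁ B₂ ρ.hi ρ.hi)

/-- The Bernstein coefficients of `lhsAt - rhsAt` on the interval of `ρ` are nonnegative. -/
def checkLower (ρ : StateRow) (c₁ c₂ B₁ B₂ : ℕ) : Bool :=
  Nat.ble (rhsAt ρ.A B₁ B₂ ρ.lo ρ.lo) (lhsAt ρ.B c₁ c₂ B₁ B₂ ρ.lo ρ.lo) &&
  Nat.ble (rhsAt ρ.A B₁ B₂ ρ.lo ρ.hi + rhsAt ρ.A B₁ B₂ ρ.hi ρ.lo)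
    (lhsAt ρ.B c₁ c₂ B₁ B₂ ρ.lo ρ.hi + lhsAt ρ.B c₁ c₂ B₁ B₂ ρ.hi ρ.lo) &&
  Nat.ble (rhsAt ρ.A B₁ B₂ ρ.hi ρ.hi) (lhsAt ρ.B c₁ c₂ B₁ B₂ ρ.hi ρ.hi)

/-- The coefficient `A` of a state, `0` if the state is missing. -/
def coefA : Option StateRow → ℕ
  | none => 0
  | some τ => τ.A

/-- The coefficient `B` of a state, `0` if the state is missing. -/
def coefB : Option StateRow → ℕ
  | none => 0
  | some τ => τ.B

/-- The image of the interval of `ρ` under `r ↦ 1 / (a + r)` lies in the interval of `τ`. -/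
def checkImage (ρ : StateRow) (a : ℕ) : Option StateRow → Bool
  | none => true
  | some τ => Nat.ble (τ.lo * (a * 10 ^ 4 + ρ.hi)) (10 ^ 8) &&
      Nat.ble (10 ^ 8) (τ.hi * (a * 10 ^ 4 + ρ.lo))

/-- All inequalities required at the row `ρ` with successors `τ₁` and `τ₂`. -/
def checkRowWith (ρ : StateRow) (τ₁ τ₂ : Option StateRow) : Bool :=
  checkImage ρ 1 τ₁ && checkImage ρ 2 τ₂ &&
  checkUpper ρ (upperWeight 1 ρ.hi * coefA τ₁ * 10 ^ 4) (upperWeight 2 ρ.hi * coefA τ₂ * 10 ^ 4)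
    (coefB τ₁) (coefB τ₂) &&
  checkLower ρ (lowerWeight 1 ρ.lo * coefA τ₁ * 10 ^ 4) (lowerWeight 2 ρ.lo * coefA τ₂ * 10 ^ 4)
    (coefB τ₁) (coefB τ₂)

/-- All inequalities required at the row `ρ`. -/
def checkRow (ρ : StateRow) : Bool :=
  Nat.ble 1 ρ.A && Nat.ble ρ.A (10 ^ 9) && Nat.ble 1 ρ.B && Nat.ble ρ.B 30000 &&
    checkRowWith ρ (nextState ρ 1) (nextState ρ 2)

/-- The interval of `ρ` contains `1 / 2`. -/
def checkRoot : Option StateRow → Bool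
  | none => false
  | some ρ => Nat.ble ρ.lo 5000 && Nat.ble 5000 ρ.hi

theorem isLengthDecreasing_stateRows : isLengthDecreasing stateRows = true := by decide +kernel

theorem isStateWord_nil : isStateWord [] = true := by decide +kernel

theorem isStateWord_tail_of_mem_stateRows :
    (stateRows.all fun ρ => isStateWord ρ.word.tail) = true := by decide +kernel

theorem isStateWord_tail_of_mem_forbiddenSym :
    (forbiddenSym.all fun v => isStateWord v.tail) = true := by decide +kernel

theorem all_checkRow : stateRows.all checkRow = true := by decide +kernel

theorem checkRoot_stateOf_nil : checkRoot (stateOf []) = true := by decide +kernel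

end Automaton

section StateMachine

theorem isStateWord_iff {l : List ℕ} : isStateWord l = true ↔ ∃ ρ ∈ stateRows, ρ.word = l := by
  simp only [isStateWord, List.any_eq_true, Bool.and_eq_true, isPrefixWord_iff]
  constructor
  · rintro ⟨ρ, hρ, h₁, h₂⟩
    exact ⟨ρ, hρ, h₁.eq_of_length (le_antisymm h₁.length_le h₂.length_le)⟩
  · rintro ⟨ρ, hρ, rfl⟩
    exact ⟨ρ, hρ, List.prefix_refl _, List.prefix_refl _⟩

theorem length_le_of_isLengthDecreasing {ρ : StateRow} {l : List StateRow}
    (hl : isLengthDecreasing (ρ :: l) = true) : ∀ τ ∈ l, τ.word.length ≤ ρ.word.length := by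
  induction l generalizing ρ with
  | nil => simp
  | cons σ l ih =>
    simp only [isLengthDecreasing, Bool.and_eq_true, Nat.ble_eq] at hl
    intro τ hτ
    rcases List.mem_cons.1 hτ with rfl | hτ
    · exact hl.1
    · exact (ih hl.2 τ hτ).trans hl.1

theorem isLengthDecreasing.tail {ρ : StateRow} {l : List StateRow}
    (hl : isLengthDecreasing (ρ :: l) = true) : isLengthDecreasing l = true := by
  cases l with
  | nil => rfl
  | cons σ l =>
    simp only [isLengthDecreasing, Bool.and_eq_true] at hl
    exact hl.2

theorem length_le_of_find?_eq_some {p : StateRow → Bool} {l : List StateRow}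
    (hl : isLengthDecreasing l = true) {ρ τ : StateRow} (hρ : l.find? p = some ρ) (hτ : τ ∈ l)
    (hp : p τ = true) : τ.word.length ≤ ρ.word.length := by
  induction l with
  | nil => simp at hτ
  | cons σ l ih =>
    by_cases hσ : p σ = true
    · rw [List.find?_cons_of_pos hσ, Option.some.injEq] at hρ
      subst hρ
      rcases List.mem_cons.1 hτ with rfl | hτ
      · exact le_rfl
      · exact length_le_of_isLengthDecreasing hl τ hτ
    · rw [List.find?_cons_of_neg hσ] at hρ
      rcases List.mem_cons.1 hτ with rfl | hτ
      · exact absurd hp hσ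
      · exact ih (isLengthDecreasing.tail hl) hρ hτ

theorem exists_stateOf (h : List ℕ) : ∃ ρ, stateOf h = some ρ := by
  obtain ⟨ρ, hρ, hw⟩ := isStateWord_iff.1 isStateWord_nil
  rw [← Option.isSome_iff_exists, stateOf, List.find?_isSome]
  exact ⟨ρ, hρ, isPrefixWord_iff.2 (by simp [hw])⟩

theorem mem_of_stateOf {h : List ℕ} {ρ : StateRow} (hρ : stateOf h = some ρ) : ρ ∈ stateRows :=
  List.mem_of_find?_eq_some hρ

theorem word_isPrefix_of_stateOf {h : List ℕ} {ρ : StateRow} (hρ : stateOf h = some ρ) :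
    ρ.word <+: h := by
  rw [stateOf] at hρ
  simpa only [isPrefixWord_iff] using List.find?_some hρ

/-- The state of `h` remembers enough of `h` to decide which words whose tail names a state are
prefixes of `a :: h`. -/
theorem isPrefixWord_cons_eq {h : List ℕ} {ρ : StateRow} (hρ : stateOf h = some ρ) (a : ℕ)
    {u : List ℕ} (hu : isStateWord u.tail = true) :
    isPrefixWord u (a :: h) = isPrefixWord u (a :: ρ.word) := by
  rw [Bool.eq_iff_iff, isPrefixWord_iff, isPrefixWord_iff]
  cases u with
  | nil => simp
  | cons b v =>
    simp only [List.cons_prefix_cons]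
    refine and_congr_right fun _ => ⟨fun hv => ?_, fun hv => hv.trans (word_isPrefix_of_stateOf hρ)⟩
    obtain ⟨τ, hτ, hw⟩ := isStateWord_iff.1 hu
    simp only [List.tail_cons] at hw
    subst hw
    exact List.prefix_of_prefix_length_le hv (word_isPrefix_of_stateOf hρ)
      (length_le_of_find?_eq_some isLengthDecreasing_stateRows hρ hτ (isPrefixWord_iff.2 hv))

theorem stateOf_cons {h : List ℕ} {ρ : StateRow} (hρ : stateOf h = some ρ) (a : ℕ) :
    stateOf (a :: h) = stateOf (a :: ρ.word) :=
  List.find?_congr fun _ hτ =>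
    isPrefixWord_cons_eq hρ a (List.all_eq_true.1 isStateWord_tail_of_mem_stateRows _ hτ)

theorem isBad_cons {h : List ℕ} {ρ : StateRow} (hρ : stateOf h = some ρ) (a : ℕ) :
    isBad (a :: h) = isBad (a :: ρ.word) := by
  rw [Bool.eq_iff_iff, isBad, isBad, List.any_eq_true, List.any_eq_true]
  refine exists_congr fun v => and_congr_right fun hv => ?_
  rw [isPrefixWord_cons_eq hρ a
    (List.all_eq_true.1 isStateWord_tail_of_mem_forbiddenSym _ hv)]

/-- The word `h` (most recent digit first) has letters in `{1, 2}` and contains no forbidden word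
and no reverse of a forbidden word. -/
def IsAdmissible : List ℕ → Prop
  | [] => True
  | a :: h => (a = 1 ∨ a = 2) ∧ isBad (a :: h) = false ∧ IsAdmissible h

theorem IsAdmissible.isDigitWord {h : List ℕ} (H : IsAdmissible h) : IsDigitWord h := by
  induction h with
  | nil => intro a ha; simp at ha
  | cons a h ih =>
    intro b hb
    rcases List.mem_cons.1 hb with rfl | hb
    · exact H.1
    · exact ih H.2.2 b hb

theorem occursAtN_iff (a : ℕ → ℕ) (i : ℕ) (w : List ℕ) :
    occursAtN a i w ↔ w.reverse <+: pastWord a (i + w.length) := by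
  induction w using List.reverseRecOn with
  | nil => simp [occursAtN]
  | append_singleton w c ih =>
    rw [List.reverse_append, List.reverse_singleton, List.singleton_append, List.length_append,
      List.length_singleton, ← add_assoc, pastWord, List.cons_prefix_cons, ← ih]
    simp only [occursAtN, List.length_append, List.length_singleton]
    constructor
    · intro H
      refine ⟨?_, fun j hj => ?_⟩
      · have := H w.length (by omega)
        simpa [List.getD_eq_getElem?_getD] using this.symm
      · have := H j (by omega)
        simpa [List.getD_eq_getElem?_getD, List.getElem?_append_left hj] using this
    · rintro ⟨h₁, h₂⟩ j hj
      rcases Nat.lt_succ_iff_lt_or_eq.1 hj with hj | rfl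
      · simpa [List.getD_eq_getElem?_getD, List.getElem?_append_left hj] using h₂ j hj
      · simpa [List.getD_eq_getElem?_getD] using h₁.symm

theorem isBad_eq_true_iff {h : List ℕ} :
    isBad h = true ↔ ∃ w ∈ forbiddenB2, w <+: h ∨ w.reverse <+: h := by
  simp only [isBad, forbiddenSym, List.any_eq_true, List.mem_append, List.mem_map,
    isPrefixWord_iff]
  constructor
  · rintro ⟨v, hv | ⟨w, hw, rfl⟩, h⟩
    · exact ⟨v, hv, Or.inl h⟩
    · exact ⟨w, hw, Or.inr h⟩
  · rintro ⟨w, hw, h | h⟩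
    · exact ⟨w, Or.inl hw, h⟩
    · exact ⟨w.reverse, Or.inr ⟨w, hw, rfl⟩, h⟩

theorem gaussCantorRev_eq_wordSet :
    gaussCantorRev {1, 2} forbiddenB2 = wordSet IsAdmissible := by
  ext x
  refine exists_congr fun a => ?_
  rw [← and_assoc]
  refine and_congr_left fun _ => ⟨fun ⟨hd, hF⟩ n => ?_, fun H => ⟨fun n => ?_, ?_⟩⟩
  · induction n with
    | zero => trivial
    | succ n ih =>
      refine ⟨by simpa using hd n, ?_, ih⟩
      rw [← Bool.not_eq_true, ← pastWord, isBad_eq_true_iff]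
      rintro ⟨w, hw, h | h⟩
      · have hlen := h.length_le
        rw [length_pastWord] at hlen
        refine (hF w hw (n + 1 - w.length)).2 ((occursAtN_iff _ _ _).2 ?_)
        rwa [List.reverse_reverse, List.length_reverse, Nat.sub_add_cancel hlen]
      · have hlen := h.length_le
        rw [length_pastWord, List.length_reverse] at hlen
        refine (hF w hw (n + 1 - w.length)).1 ((occursAtN_iff _ _ _).2 ?_)
        rwa [Nat.sub_add_cancel hlen]
  · simpa using (H (n + 1)).1
  · intro w hw i
    have hpos : 0 < w.length := by
      revert w
      decide
    obtain ⟨m, hm⟩ := Nat.exists_eq_add_of_le' (show 1 ≤ i + w.length by omega)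
    have hbad : isBad (pastWord a (i + w.length)) = false := by
      rw [hm]
      exact (H (m + 1)).2.1
    rw [← Bool.not_eq_true, isBad_eq_true_iff] at hbad
    constructor
    · exact fun h => hbad ⟨w, hw, Or.inr ((occursAtN_iff _ _ _).1 h)⟩
    · intro h
      rw [occursAtN_iff, List.reverse_reverse, List.length_reverse] at h
      exact hbad ⟨w, hw, Or.inl h⟩

end StateMachine

section Certificate

theorem nextState_eq {h : List ℕ} {ρ : StateRow} (hρ : stateOf h = some ρ) (a : ℕ) :
    nextState ρ a = if isBad (a :: h) then none else stateOf (a :: h) := by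
  rw [nextState, stateOf_cons hρ, isBad_cons hρ]

theorem checkRow_iff {ρ : StateRow} : checkRow ρ = true ↔
    1 ≤ ρ.A ∧ ρ.A ≤ 10 ^ 9 ∧ 1 ≤ ρ.B ∧ ρ.B ≤ 30000 ∧
    checkImage ρ 1 (nextState ρ 1) = true ∧ checkImage ρ 2 (nextState ρ 2) = true ∧
    checkUpper ρ (upperWeight 1 ρ.hi * coefA (nextState ρ 1) * 10 ^ 4)
      (upperWeight 2 ρ.hi * coefA (nextState ρ 2) * 10 ^ 4)
      (coefB (nextState ρ 1)) (coefB (nextState ρ 2)) = true ∧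
    checkLower ρ (lowerWeight 1 ρ.lo * coefA (nextState ρ 1) * 10 ^ 4)
      (lowerWeight 2 ρ.lo * coefA (nextState ρ 2) * 10 ^ 4)
      (coefB (nextState ρ 1)) (coefB (nextState ρ 2)) = true := by
  simp only [checkRow, checkRowWith, Bool.and_eq_true, Nat.ble_eq, and_assoc]

theorem checkRow_of_stateOf {h : List ℕ} {ρ : StateRow} (hρ : stateOf h = some ρ) :
    checkRow ρ = true :=
  List.all_eq_true.1 all_checkRow _ (mem_of_stateOf hρ)

/-- The interval of the state of `h` contains the ratio of denominators of `h`. -/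
theorem denRatio_mem_interval {h : List ℕ} (H : IsAdmissible h) {ρ : StateRow}
    (hρ : stateOf h = some ρ) :
    (ρ.lo : ℝ) ≤ 10 ^ 4 * denRatio h ∧ 10 ^ 4 * denRatio h ≤ ρ.hi := by
  induction h generalizing ρ with
  | nil =>
    have hroot := checkRoot_stateOf_nil
    rw [hρ] at hroot
    simp only [checkRoot, Bool.and_eq_true, Nat.ble_eq] at hroot
    have h₁ : (ρ.lo : ℝ) ≤ 5000 := by exact_mod_cast hroot.1
    have h₂ : (5000 : ℝ) ≤ ρ.hi := by exact_mod_cast hroot.2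
    simp only [denRatio]
    constructor <;> linarith
  | cons a h ih =>
    obtain ⟨σ, hσ⟩ := exists_stateOf h
    obtain ⟨hlo, hhi⟩ := ih H.2.2 hσ
    have hr := denRatio_mem H.2.2.isDigitWord
    have hnext : nextState σ a = some ρ := by
      rw [nextState_eq hσ, H.2.1, hρ]
      simp
    have himage : checkImage σ a (nextState σ a) = true := by
      obtain ⟨-, -, -, -, h₁, h₂, -⟩ := checkRow_iff.1 (checkRow_of_stateOf hσ)
      rcases H.1 with rfl | rfl
      exacts [h₁, h₂]
    rw [hnext] at himage
    simp only [checkImage, Bool.and_eq_true, Nat.ble_eq] at himage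
    have h₁ : (ρ.lo : ℝ) * (a * 10 ^ 4 + σ.hi) ≤ 10 ^ 8 := by exact_mod_cast himage.1
    have h₂ : (10 ^ 8 : ℝ) ≤ ρ.hi * (a * 10 ^ 4 + σ.lo) := by exact_mod_cast himage.2
    have hy : 0 < (a : ℝ) + denRatio h := by linarith [(Nat.cast_nonneg a : (0 : ℝ) ≤ a)]
    rw [denRatio, mul_one_div, le_div_iff₀ hy, div_le_iff₀ hy]
    have h₃ : (ρ.lo : ℝ) * (10 ^ 4 * denRatio h) ≤ ρ.lo * σ.hi := by gcongr
    have h₄ : (ρ.hi : ℝ) * σ.lo ≤ ρ.hi * (10 ^ 4 * denRatio h) := by gcongr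
    constructor <;> linarith

/-- A quadratic polynomial with nonnegative Bernstein coefficients on an interval is nonnegative
there. -/
theorem quadratic_nonneg_of_bernstein {α β δ l u x : ℝ} (hl : l ≤ x) (hu : x ≤ u)
    (h₀ : 0 ≤ α + β * l + δ * l ^ 2) (h₁ : 0 ≤ 2 * α + β * (l + u) + 2 * δ * (l * u))
    (h₂ : 0 ≤ α + β * u + δ * u ^ 2) : 0 ≤ α + β * x + δ * x ^ 2 := by
  rcases (hl.trans hu).eq_or_lt with rfl | hlu
  · rwa [← le_antisymm hl hu]
  · have hl := sub_nonneg.2 hl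
    have hu := sub_nonneg.2 hu
    have hsum : 0 ≤ (u - x) ^ 2 * (α + β * l + δ * l ^ 2) +
        (u - x) * (x - l) * (2 * α + β * (l + u) + 2 * δ * (l * u)) +
        (x - l) ^ 2 * (α + β * u + δ * u ^ 2) := by positivity
    refine nonneg_of_mul_nonneg_right (a := (u - l) ^ 2) ?_ (pow_pos (sub_pos.2 hlu) 2)
    linarith

/-- The Gauss transfer inequality at `R` follows from the upper check. -/
theorem transfer_le_of_checkUpper {ρ : StateRow} {c₁ c₂ B₁ B₂ : ℕ}
    (hc : checkUpper ρ c₁ c₂ B₁ B₂ = true) {R : ℝ} (hlo : (ρ.lo : ℝ) ≤ R) (hhi : R ≤ ρ.hi) :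
    (R + ρ.B) * (c₁ * (10 ^ 8 + B₂ * (2 * 10 ^ 4 + R)) + c₂ * (10 ^ 8 + B₁ * (10 ^ 4 + R))) ≤
      ρ.A * 10 ^ 10 * (10 ^ 8 + B₁ * (10 ^ 4 + R)) * (10 ^ 8 + B₂ * (2 * 10 ^ 4 + R)) := by
  simp only [checkUpper, lhsAt, rhsAt, denomAt, Bool.and_eq_true, Nat.ble_eq] at hc
  obtain ⟨⟨h₀, h₁⟩, h₂⟩ := hc
  rify at h₀ h₁ h₂
  have key := quadratic_nonneg_of_bernstein hlo hhi
    (α := ρ.A * 10 ^ 10 * (10 ^ 8 + B₁ * 10 ^ 4) * (10 ^ 8 + B₂ * (2 * 10 ^ 4)) -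
      ρ.B * (c₁ * (10 ^ 8 + B₂ * (2 * 10 ^ 4)) + c₂ * (10 ^ 8 + B₁ * 10 ^ 4)))
    (β := ρ.A * 10 ^ 10 * ((10 ^ 8 + B₁ * 10 ^ 4) * B₂ + B₁ * (10 ^ 8 + B₂ * (2 * 10 ^ 4))) -
      (c₁ * (10 ^ 8 + B₂ * (2 * 10 ^ 4)) + c₂ * (10 ^ 8 + B₁ * 10 ^ 4) +
        ρ.B * (c₁ * B₂ + c₂ * B₁)))
    (δ := ρ.A * 10 ^ 10 * (B₁ * B₂) - (c₁ * B₂ + c₂ * B₁))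
    (by linear_combination h₀) (by linear_combination h₁) (by linear_combination h₂)
  linear_combination key

/-- The reverse Gauss transfer inequality at `R` follows from the lower check. -/
theorem le_transfer_of_checkLower {ρ : StateRow} {c₁ c₂ B₁ B₂ : ℕ}
    (hc : checkLower ρ c₁ c₂ B₁ B₂ = true) {R : ℝ} (hlo : (ρ.lo : ℝ) ≤ R) (hhi : R ≤ ρ.hi) :
    ρ.A * 10 ^ 10 * (10 ^ 8 + B₁ * (10 ^ 4 + R)) * (10 ^ 8 + B₂ * (2 * 10 ^ 4 + R)) ≤
      (R + ρ.B) *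
        (c₁ * (10 ^ 8 + B₂ * (2 * 10 ^ 4 + R)) + c₂ * (10 ^ 8 + B₁ * (10 ^ 4 + R))) := by
  simp only [checkLower, lhsAt, rhsAt, denomAt, Bool.and_eq_true, Nat.ble_eq] at hc
  obtain ⟨⟨h₀, h₁⟩, h₂⟩ := hc
  rify at h₀ h₁ h₂
  have key := quadratic_nonneg_of_bernstein hlo hhi
    (α := ρ.B * (c₁ * (10 ^ 8 + B₂ * (2 * 10 ^ 4)) + c₂ * (10 ^ 8 + B₁ * 10 ^ 4)) -
      ρ.A * 10 ^ 10 * (10 ^ 8 + B₁ * 10 ^ 4) * (10 ^ 8 + B₂ * (2 * 10 ^ 4)))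
    (β := c₁ * (10 ^ 8 + B₂ * (2 * 10 ^ 4)) + c₂ * (10 ^ 8 + B₁ * 10 ^ 4) +
        ρ.B * (c₁ * B₂ + c₂ * B₁) -
      ρ.A * 10 ^ 10 * ((10 ^ 8 + B₁ * 10 ^ 4) * B₂ + B₁ * (10 ^ 8 + B₂ * (2 * 10 ^ 4))))
    (δ := c₁ * B₂ + c₂ * B₁ - ρ.A * 10 ^ 10 * (B₁ * B₂))
    (by linear_combination h₀) (by linear_combination h₁) (by linear_combination h₂)
  linear_combination key

theorem rpow_le_upperWeight {a hi : ℕ} (ha : 1 ≤ a) {r : ℝ} (hr : 0 ≤ r)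
    (hhi : 10 ^ 4 * r ≤ hi) :
    ((a : ℝ) + r) ^ (12 / 10 ^ 6 : ℝ) ≤ upperWeight a hi / 10 ^ 10 := by
  have ha' : (1 : ℝ) ≤ a := by exact_mod_cast ha
  have h := rpow_one_add_le_one_add_mul_self (s := a + r - 1) (by linarith)
    (p := 12 / 10 ^ 6) (by norm_num) (by norm_num)
  rw [add_sub_cancel] at h
  refine h.trans ?_
  rw [upperWeight]
  push_cast [ha]
  linarith

theorem lowerWeight_le_rpow {a lo : ℕ} (ha : 1 ≤ a) {r : ℝ} (hr : 0 ≤ r)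
    (hlo : lo ≤ 10 ^ 4 * r) :
    (lowerWeight a lo : ℝ) / 10 ^ 10 ≤ ((a : ℝ) + r) ^ (48 / 10 ^ 6 : ℝ) := by
  have ha' : (1 : ℝ) ≤ a := by exact_mod_cast ha
  set x : ℝ := a + r - 1 with hx
  have hx0 : 0 ≤ x := by linarith
  have hy : (a : ℝ) + r = 1 + x := by ring
  set z : ℝ := ((a : ℝ) - 1) * 10 ^ 4 + lo with hz
  have hz0 : 0 ≤ z := by
    have : (0 : ℝ) ≤ lo := Nat.cast_nonneg lo
    nlinarith
  have hzx : z ≤ 10 ^ 4 * x := by linarith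
  have hdiv : (((960000 * ((a - 1) * 10 ^ 4 + lo) / ((a - 1) * 10 ^ 4 + lo + 20000) : ℕ)) : ℝ) ≤
      960000 * z / (z + 20000) := by
    refine Nat.cast_div_le.trans (le_of_eq ?_)
    push_cast [ha]
    rw [hz]
    norm_num
  have hmono : 960000 * z / (z + 20000) ≤ 480000 * (2 * x / (x + 2)) := by
    rw [← mul_div_assoc, div_le_div_iff₀ (by positivity) (by positivity)]
    nlinarith
  have hlog := Real.le_log_one_add_of_nonneg hx0
  have hexp := Real.add_one_le_exp (Real.log (1 + x) * (48 / 10 ^ 6))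
  rw [hy, Real.rpow_def_of_pos (by linarith), lowerWeight]
  push_cast
  linarith

/-- The test function attached to a state, `0` if the state is missing. -/
noncomputable def testFun : Option StateRow → ℝ → ℝ
  | none, _ => 0
  | some τ, r => τ.A / (r + τ.B / 10 ^ 4)

theorem inv_mul_testFun (τ : Option StateRow) {y : ℝ} (hy : 0 < y) :
    y⁻¹ * testFun τ (1 / y) = coefA τ / (1 + coefB τ / 10 ^ 4 * y) := by
  cases τ with
  | none => simp [testFun, coefA]
  | some τ =>
    simp only [testFun, coefA, coefB]
    have h : (0 : ℝ) < 1 + τ.B / 10 ^ 4 * y := by positivity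
    field_simp

theorem upper_step {h : List ℕ} (H : IsAdmissible h) {ρ : StateRow} (hρ : stateOf h = some ρ) :
    (1 + denRatio h) ^ (12 / 10 ^ 6 : ℝ) * (coefA (nextState ρ 1) /
        (1 + coefB (nextState ρ 1) / 10 ^ 4 * (1 + denRatio h))) +
      (2 + denRatio h) ^ (12 / 10 ^ 6 : ℝ) * (coefA (nextState ρ 2) /
        (1 + coefB (nextState ρ 2) / 10 ^ 4 * (2 + denRatio h))) ≤
      testFun (some ρ) (denRatio h) := by
  obtain ⟨hlo, hhi⟩ := denRatio_mem_interval H hρ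
  have hr : 0 ≤ denRatio h := by linarith [(denRatio_mem H.isDigitWord).1]
  obtain ⟨-, -, hB, -, -, -, hc, -⟩ := checkRow_iff.1 (checkRow_of_stateOf hρ)
  have htr := transfer_le_of_checkUpper hc hlo hhi
  have hw₁ := rpow_le_upperWeight le_rfl hr hhi
  have hw₂ := rpow_le_upperWeight one_le_two hr hhi
  rw [Nat.cast_one] at hw₁
  rw [Nat.cast_two] at hw₂
  generalize denRatio h = r at *
  generalize coefA (nextState ρ 1) = A₁ at *
  generalize coefA (nextState ρ 2) = A₂ at *
  generalize coefB (nextState ρ 1) = B₁ at *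
  generalize coefB (nextState ρ 2) = B₂ at *
  generalize upperWeight 1 ρ.hi = w₁ at *
  generalize upperWeight 2 ρ.hi = w₂ at *
  refine (add_le_add (mul_le_mul_of_nonneg_right hw₁ (by positivity))
    (mul_le_mul_of_nonneg_right hw₂ (by positivity))).trans ?_
  have hB' : (0 : ℝ) < ρ.B := by exact_mod_cast hB
  have hd₁ : (0 : ℝ) < 1 + B₁ / 10 ^ 4 * (1 + r) := by positivity
  have hd₂ : (0 : ℝ) < 1 + B₂ / 10 ^ 4 * (2 + r) := by positivity
  have hd : 0 < r + ρ.B / 10 ^ 4 := by positivity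
  rw [testFun, ← mul_div_assoc, ← mul_div_assoc, div_add_div _ _ hd₁.ne' hd₂.ne',
    div_le_div_iff₀ (mul_pos hd₁ hd₂) hd]
  push_cast at htr
  linear_combination (1 / 10 ^ 26) * htr

theorem lower_step {h : List ℕ} (H : IsAdmissible h) {ρ : StateRow} (hρ : stateOf h = some ρ) :
    testFun (some ρ) (denRatio h) ≤
      (1 + denRatio h) ^ (48 / 10 ^ 6 : ℝ) * (coefA (nextState ρ 1) /
        (1 + coefB (nextState ρ 1) / 10 ^ 4 * (1 + denRatio h))) +
      (2 + denRatio h) ^ (48 / 10 ^ 6 : ℝ) * (coefA (nextState ρ 2) /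
        (1 + coefB (nextState ρ 2) / 10 ^ 4 * (2 + denRatio h))) := by
  obtain ⟨hlo, hhi⟩ := denRatio_mem_interval H hρ
  have hr : 0 ≤ denRatio h := by linarith [(denRatio_mem H.isDigitWord).1]
  obtain ⟨-, -, hB, -, -, -, -, hc⟩ := checkRow_iff.1 (checkRow_of_stateOf hρ)
  have htr := le_transfer_of_checkLower hc hlo hhi
  have hw₁ := lowerWeight_le_rpow le_rfl hr hlo
  have hw₂ := lowerWeight_le_rpow one_le_two hr hlo
  rw [Nat.cast_one] at hw₁
  rw [Nat.cast_two] at hw₂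
  generalize denRatio h = r at *
  generalize coefA (nextState ρ 1) = A₁ at *
  generalize coefA (nextState ρ 2) = A₂ at *
  generalize coefB (nextState ρ 1) = B₁ at *
  generalize coefB (nextState ρ 2) = B₂ at *
  generalize lowerWeight 1 ρ.lo = w₁ at *
  generalize lowerWeight 2 ρ.lo = w₂ at *
  refine le_trans ?_ (add_le_add (mul_le_mul_of_nonneg_right hw₁ (by positivity))
    (mul_le_mul_of_nonneg_right hw₂ (by positivity)))
  have hB' : (0 : ℝ) < ρ.B := by exact_mod_cast hB
  have hd₁ : (0 : ℝ) < 1 + B₁ / 10 ^ 4 * (1 + r) := by positivity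
  have hd₂ : (0 : ℝ) < 1 + B₂ / 10 ^ 4 * (2 + r) := by positivity
  have hd : 0 < r + ρ.B / 10 ^ 4 := by positivity
  rw [testFun, ← mul_div_assoc, ← mul_div_assoc, div_add_div _ _ hd₁.ne' hd₂.ne',
    div_le_div_iff₀ hd (mul_pos hd₁ hd₂)]
  push_cast at htr
  linear_combination (1 / 10 ^ 26) * htr

end Certificate

section Potential

open scoped Classical in
/-- The weight of an admissible word at exponent `t`: the `t`-th power of its scale, corrected by
the test function of its state. Other words have weight `0`. -/
noncomputable def potential (t : ℝ) (h : List ℕ) : ℝ :=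
  if IsAdmissible h then ((wordDen h ^ 2)⁻¹) ^ t * testFun (stateOf h) (denRatio h) else 0

theorem potential_of_not_isAdmissible {t : ℝ} {h : List ℕ} (H : ¬IsAdmissible h) :
    potential t h = 0 := if_neg H

theorem testFun_mem {h : List ℕ} (H : IsAdmissible h) :
    1 / 4 ≤ testFun (stateOf h) (denRatio h) ∧ testFun (stateOf h) (denRatio h) ≤ 10 ^ 13 := by
  obtain ⟨ρ, hρ⟩ := exists_stateOf h
  have hr := denRatio_mem H.isDigitWord
  obtain ⟨hA, hA', hB, hB', -⟩ := checkRow_iff.1 (checkRow_of_stateOf hρ)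
  rify at hA hA' hB hB'
  rw [hρ, testFun]
  have hd : 0 < denRatio h + ρ.B / 10 ^ 4 := by linarith
  rw [le_div_iff₀ hd, div_le_iff₀ hd]
  constructor <;> linarith

theorem potential_nonneg (t : ℝ) (h : List ℕ) : 0 ≤ potential t h := by
  rw [potential]
  split_ifs with H
  · have := (testFun_mem H).1
    positivity
  · exact le_rfl

theorem potential_cons (t : ℝ) {h : List ℕ} (H : IsAdmissible h) {ρ : StateRow}
    (hρ : stateOf h = some ρ) {a : ℕ} (ha : a = 1 ∨ a = 2) :
    potential t (a :: h) = ((wordDen h ^ 2)⁻¹) ^ t * ((a + denRatio h) ^ (1 - 2 * t) *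
      (coefA (nextState ρ a) / (1 + coefB (nextState ρ a) / 10 ^ 4 * (a + denRatio h)))) := by
  have hr := denRatio_mem H.isDigitWord
  have hy : 0 < (a : ℝ) + denRatio h := by linarith [(Nat.cast_nonneg a : (0 : ℝ) ≤ a)]
  rw [nextState_eq hρ]
  by_cases hbad : isBad (a :: h) = true
  · rw [potential_of_not_isAdmissible fun H' => by simp [H'.2.1] at hbad]
    simp [hbad, coefA]
  · rw [Bool.not_eq_true] at hbad
    have H' : IsAdmissible (a :: h) := ⟨ha, hbad, H⟩
    have hpow : (((a + denRatio h) ^ 2)⁻¹) ^ t =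
        ((a : ℝ) + denRatio h) ^ (1 - 2 * t) * ((a : ℝ) + denRatio h)⁻¹ := by
      rw [← Real.rpow_neg_one ((a : ℝ) + denRatio h), ← Real.rpow_add hy, ← Real.rpow_natCast,
        ← Real.rpow_neg hy.le, ← Real.rpow_mul hy.le]
      congr 1
      push_cast
      ring
    rw [potential, if_pos H', wordDen, denRatio, mul_pow, mul_inv, Real.mul_rpow (by positivity)
      (by positivity), hpow, hbad, if_neg Bool.false_ne_true, ← inv_mul_testFun _ hy]
    ring

theorem potential_step_le {t : ℝ} (ht : 1 - 2 * t = 12 / 10 ^ 6) (h : List ℕ) :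
    potential t (1 :: h) + potential t (2 :: h) ≤ potential t h := by
  by_cases H : IsAdmissible h
  · obtain ⟨ρ, hρ⟩ := exists_stateOf h
    rw [potential_cons t H hρ (Or.inl rfl), potential_cons t H hρ (Or.inr rfl), ht, ← mul_add,
      Nat.cast_one, Nat.cast_two]
    rw [potential, if_pos H, hρ]
    exact mul_le_mul_of_nonneg_left (upper_step H hρ) (by positivity)
  · have hcons : ∀ a, potential t (a :: h) = 0 := fun a =>
      potential_of_not_isAdmissible fun H' : IsAdmissible (a :: h) => H H'.2.2
    rw [potential_of_not_isAdmissible H, hcons, hcons, add_zero]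

theorem le_potential_step {t : ℝ} (ht : 1 - 2 * t = 48 / 10 ^ 6) (h : List ℕ) :
    potential t h ≤ potential t (1 :: h) + potential t (2 :: h) := by
  by_cases H : IsAdmissible h
  · obtain ⟨ρ, hρ⟩ := exists_stateOf h
    rw [potential_cons t H hρ (Or.inl rfl), potential_cons t H hρ (Or.inr rfl), ht, ← mul_add,
      Nat.cast_one, Nat.cast_two]
    rw [potential, if_pos H, hρ]
    exact mul_le_mul_of_nonneg_left (lower_step H hρ) (by positivity)
  · have hcons : ∀ a, potential t (a :: h) = 0 := fun a =>
      potential_of_not_isAdmissible fun H' : IsAdmissible (a :: h) => H H'.2.2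
    rw [potential_of_not_isAdmissible H, hcons, hcons, add_zero]

theorem dimH_wordSet_isAdmissible_le :
    dimH (wordSet IsAdmissible) ≤ ((499994 / 10 ^ 6 : NNReal) : ENNReal) := by
  refine dimH_wordSet_le (fun h H => H.isDigitWord) (by positivity)
    (potential_nonneg ((499994 / 10 ^ 6 : NNReal) : ℝ)) (c := 4) (by norm_num) (fun h H => ?_)
    (potential_step_le (by push_cast; norm_num))
  rw [potential, if_pos H]
  have h₁ := (testFun_mem H).1
  have h₂ : 0 ≤ ((wordDen h ^ 2)⁻¹) ^ ((499994 / 10 ^ 6 : NNReal) : ℝ) := by positivity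
  nlinarith

theorem le_dimH_wordSet_isAdmissible :
    ((499976 / 10 ^ 6 : NNReal) : ENNReal) ≤ dimH (wordSet IsAdmissible) := by
  refine le_dimH_wordSet (fun h H => H.isDigitWord) (by positivity)
    (potential_nonneg ((499976 / 10 ^ 6 : NNReal) : ℝ))
    (fun h H => potential_of_not_isAdmissible H) (C := 10 ^ 13) (by norm_num) (fun h H => ?_)
    (le_potential_step (by push_cast; norm_num)) ?_
  · rw [potential, if_pos H, mul_comm]
    exact mul_le_mul_of_nonneg_right (testFun_mem H).2 (by positivity)
  · have H : IsAdmissible [] := trivial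
    have := (testFun_mem H).1
    rw [potential, if_pos H, wordDen]
    simp only [one_pow, inv_one, Real.one_rpow, one_mul]
    linarith

end Potential

/-- `0.499975 < dim_H B₂ < 0.499995`, where `B₂` is the set of reals whose continued fraction
partial quotients lie in `{1,2}` and avoid the sixteen listed strings and their
reverses. -/
theorem dimH_B2_bounds :
    ENNReal.ofReal 0.499975 < dimH (gaussCantorRev {1, 2} forbiddenB2) ∧
    dimH (gaussCantorRev {1, 2} forbiddenB2) < ENNReal.ofReal 0.499995 := by
  rw [gaussCantorRev_eq_wordSet]
  constructor
  · refine lt_of_lt_of_le ?_ le_dimH_wordSet_isAdmissible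
    rw [← ENNReal.ofReal_coe_nnreal, ENNReal.ofReal_lt_ofReal_iff_of_nonneg (by norm_num)]
    push_cast
    norm_num
  · refine lt_of_le_of_lt dimH_wordSet_isAdmissible_le ?_
    rw [← ENNReal.ofReal_coe_nnreal, ENNReal.ofReal_lt_ofReal_iff_of_nonneg (by positivity)]
    push_cast
    norm_num
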